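/- Fix y > 0 and set C₀ = 2/log(2+√3). For N ≥ 1 let U_N = { x ∈ (0,1) irrational : max_{1≤i≤N} a_i(x) ≤ C₀ N y }. Then for every fixed M ≥ 1, lim_{N→∞} μ(U_N ∩ U_M) = exp(−1/y) · μ(U_M). -/

import Mathlib

open MeasureTheory Real Set Filter Topology

namespace SCF

/-- The involution `ι(x) = (1−x)/(1+x)`. -/
noncomputable def iota (x : ℝ) : ℝ := (1 - x) / (1 + x)

/-- Even continued-fraction step.  For `y ∈ (0,1/2]` one has
`⌊(1/y+1)/2⌋ = k` whenever `1/y ∈ (2k−1, 2k+1)`, so `Te y = |1/y − 2k|`;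
explicitly `Te y = 1/y − 2` on `[1/3,1/2]`, `Te y = 1/y − 2k` on
`[1/(2k+1), 1/(2k))` and `Te y = 2k − 1/y` on `[1/(2k), 1/(2k−1))` (`k ≥ 2`). -/
noncomputable def Te (y : ℝ) : ℝ := |1 / y - 2 * (⌊(1 / y + 1) / 2⌋ : ℝ)|

/-- The spliced continued fraction (SCF) map `T : [0,1] → [0,1]`, with
`T 0 = 0`, `T 1 = 1`.  On `(0,1/2]` it is the even continued fraction map
(see `Te`), and on `(1/2,1)` it is the odd–odd map, which is the conjugate
`ι ∘ Te ∘ ι` of the even map; this agrees with the branchwise definition: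
`T x = (k x − (k−1))/(k − (k+1) x)` on `((k−1)/k, (2k−1)/(2k+1)]` and
`T x = (k − (k+1) x)/(k x − (k−1))` on `((2k−1)/(2k+1), k/(k+1)]` for `k ≥ 2`. -/
noncomputable def T (x : ℝ) : ℝ :=
  if x ≤ 0 then 0
  else if 1 ≤ x then 1
  else if x ≤ 1 / 2 then Te x
  else iota (Te (iota x))

/-- Parity label of a digit: `e` (even cusp) or `o` (odd–odd cusp). -/
inductive Par | e | o
deriving DecidableEq

/-- A candidate SCF digit `(a, ε)_s`. -/
structure Digit where
  a : ℤ
  eps : ℤ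
  s : Par
deriving DecidableEq

/-- The digit set `𝒜 = {(k,ε)_s : k ≥ 2, ε = ±1, s ∈ {e,o}} ∪ {(1,+1)_e}`. -/
def Digit.Valid (d : Digit) : Prop :=
  (2 ≤ d.a ∧ (d.eps = 1 ∨ d.eps = -1)) ∨ (d.a = 1 ∧ d.eps = 1 ∧ d.s = Par.e)

/-- The branch intervals `I_{(a,ε)_s}` of the SCF map. -/
noncomputable def branch (d : Digit) : Set ℝ :=
  match d.s with
  | Par.e =>
      if d.a = 1 then Set.Icc (1/3 : ℝ) (1/2)
      else if d.eps = 1 then Set.Ico (1 / (2 * (d.a : ℝ) + 1)) (1 / (2 * (d.a : ℝ)))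
      else Set.Ico (1 / (2 * (d.a : ℝ))) (1 / (2 * (d.a : ℝ) - 1))
  | Par.o =>
      if d.eps = 1 then
        Set.Ioc ((2 * (d.a : ℝ) - 1) / (2 * (d.a : ℝ) + 1)) ((d.a : ℝ) / ((d.a : ℝ) + 1))
      else
        Set.Ioc (((d.a : ℝ) - 1) / (d.a : ℝ)) ((2 * (d.a : ℝ) - 1) / (2 * (d.a : ℝ) + 1))

open Classical in
/-- The SCF digit of a point `y` (the unique valid digit `d` with `y ∈ I_d`;
well defined for every `y ∈ (0,1)`). -/
noncomputable def digit (y : ℝ) : Digit :=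
  if h : ∃ d : Digit, d.Valid ∧ y ∈ branch d then h.choose else ⟨1, 1, Par.e⟩

/-- The `n`-th SCF digit `(a_n(x), ε_n(x))_{s_n(x)}` of `x`, `n ≥ 1`,
determined by `T^[n−1] x ∈ I_{(a_n,ε_n)_{s_n}}`. -/
noncomputable def dig (n : ℕ) (x : ℝ) : Digit := digit (T^[n - 1] x)

/-- The `n`-th SCF partial quotient `a_n(x)`. -/
noncomputable def a (n : ℕ) (x : ℝ) : ℤ := (dig n x).a

/-- The invariant density `f_μ`. -/
noncomputable def fdens (x : ℝ) : ℝ :=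
  2 / (Real.log (2 + Real.sqrt 3) * (1 - (2 - Real.sqrt 3) * x) * (1 + Real.sqrt 3 * x))

/-- The absolutely continuous `T`-invariant probability measure `μ` on `(0,1)`. -/
noncomputable def mu : Measure ℝ :=
  (volume.restrict (Set.Ioo (0 : ℝ) 1)).withDensity fun x => ENNReal.ofReal (fdens x)

/-- The inverse branches `h_{(a,ε)_s}` of the SCF map `T`. -/
noncomputable def h (d : Digit) (x : ℝ) : ℝ :=
  match d.s with
  | Par.e => 1 / (2 * (d.a : ℝ) + (d.eps : ℝ) * x)
  | Par.o =>
      if d.eps = 1 then (((d.a : ℝ) - 1) * x + (d.a : ℝ)) / ((d.a : ℝ) * x + ((d.a : ℝ) + 1))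
      else ((d.a : ℝ) * x + ((d.a : ℝ) - 1)) / (((d.a : ℝ) + 1) * x + (d.a : ℝ))

/-- Composed inverse branch `h_{A^{(n)}} = h_{A₁} ∘ ⋯ ∘ h_{A_n}` of a word. -/
noncomputable def hWord (l : List Digit) : ℝ → ℝ :=
  l.foldr (fun d g => h d ∘ g) id

/-- The dual inverse branches `bar h_{(b,η)_t}`. -/
noncomputable def hbar (d : Digit) (y : ℝ) : ℝ :=
  match d.s with
  | Par.e => (d.eps : ℝ) / (2 * (d.a : ℝ) + y)
  | Par.o =>
      1 / (1 + (d.eps : ℝ) / (((d.a : ℝ) - ((max 0 d.eps : ℤ) : ℝ)) + 1 / (1 + y)))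

/-- The matrix `M_{(a,ε)_s}` associated with the inverse branch `h_{(a,ε)_s}`. -/
noncomputable def Mdig (d : Digit) : Matrix (Fin 2) (Fin 2) ℝ :=
  match d.s with
  | Par.e => !![0, 1; (d.eps : ℝ), 2 * (d.a : ℝ)]
  | Par.o =>
      !![(d.a : ℝ) - ((max 0 d.eps : ℤ) : ℝ), (d.a : ℝ) - ((max 0 d.eps : ℤ) : ℝ) + (d.eps : ℝ);
         (d.a : ℝ) - ((max 0 d.eps : ℤ) : ℝ) + 1, (d.a : ℝ) - ((max 0 d.eps : ℤ) : ℝ) + (d.eps : ℝ) + 1]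

/-- `M_n(x) = M_{(a₁,ε₁)_{s₁}} ⋯ M_{(a_n,ε_n)_{s_n}}`. -/
noncomputable def Mn (n : ℕ) (x : ℝ) : Matrix (Fin 2) (Fin 2) ℝ :=
  ((List.range n).map fun i => Mdig (digit (T^[i] x))).prod

/-- `P_n(x)`: the `(1,2)`-entry of `M_n(x)` (numerator of the `n`-th convergent). -/
noncomputable def Pc (n : ℕ) (x : ℝ) : ℝ := Mn n x 0 1

/-- `Q_n(x)`: the `(2,2)`-entry of `M_n(x)` (denominator of the `n`-th convergent). -/
noncomputable def Qc (n : ℕ) (x : ℝ) : ℝ := Mn n x 1 1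



/-! ### Branches -/

/-- Index type of the inverse branches. -/
inductive Br | ep (n : ℕ) | em (n : ℕ) | op (n : ℕ) | om (n : ℕ)

instance : Countable Br := by
  let f : Br → ℕ × ℕ := fun d => match d with
    | .ep n => (0, n) | .em n => (1, n) | .op n => (2, n) | .om n => (3, n)
  have hf : Function.Injective f := by
    intro d e hde
    cases d <;> cases e <;> simp_all [f]
  exact hf.countable

/-- partial quotient of a branch -/
def kB : Br → ℤ
  | .ep n => n + 1 | .em n => n + 2 | .op n => n + 2 | .om n => n + 2

def cp : Br → ℝ
  | .ep _ => 0 | .em _ => 0 | .op n => n + 1 | .om n => n + 2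
def cq : Br → ℝ
  | .ep _ => 1 | .em _ => 1 | .op n => n + 2 | .om n => n + 1
def cr : Br → ℝ
  | .ep _ => 1 | .em _ => -1 | .op n => n + 2 | .om n => n + 3
def cs : Br → ℝ
  | .ep n => 2 * (n + 1) | .em n => 2 * (n + 2) | .op n => n + 3 | .om n => n + 2

noncomputable def hB (d : Br) (x : ℝ) : ℝ := (cp d * x + cq d) / (cr d * x + cs d)

/-- a measurable version of the partial quotient -/
noncomputable def kk (x : ℝ) : ℤ := if x ≤ 1 / 2 then ⌊(1 / x + 1) / 2⌋ else ⌊1 / (1 - x)⌋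

lemma den_pos (d : Br) {x : ℝ} (h0 : 0 ≤ x) (h1 : x ≤ 1) : 0 < cr d * x + cs d := by
  cases d with
  | ep n => simp only [cr, cs]; positivity
  | em n => simp only [cr, cs]; have : (0 : ℝ) ≤ n := n.cast_nonneg; linarith
  | op n => simp only [cr, cs]; positivity
  | om n => simp only [cr, cs]; positivity

lemma det_abs (d : Br) : |cp d * cs d - cq d * cr d| = 1 := by
  cases d with
  | ep n => simp [cp, cq, cr, cs]
  | em n => simp [cp, cq, cr, cs]
  | op n => simp only [cp, cq, cr, cs]; ring_nf; norm_num
  | om n => simp only [cp, cq, cr, cs]; ring_nf; norm_num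

lemma Te_of {y : ℝ} {k : ℤ} {s : ℝ} (hs0 : -1 ≤ s) (hs1 : s < 1) (hy : 1 / y = 2 * k + s) :
    Te y = |s| := by
  have : ⌊(1 / y + 1) / 2⌋ = k := by
    rw [Int.floor_eq_iff, hy]; constructor <;> linarith
  rw [Te, this, hy]; congr 1; ring

lemma iota_iota {x : ℝ} (hx : 1 + x ≠ 0) : iota (iota x) = x := by
  unfold iota; field_simp; ring

lemma T_e {x : ℝ} (h0 : 0 < x) (h1 : x ≤ 1 / 2) : T x = Te x := by
  rw [T, if_neg (by linarith), if_neg (by linarith), if_pos h1]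

lemma T_o {x : ℝ} (h0 : 1 / 2 < x) (h1 : x < 1) : T x = iota (Te (iota x)) := by
  rw [T, if_neg (by linarith), if_neg (by linarith), if_neg (by linarith)]

lemma hB_ep (n : ℕ) (x : ℝ) : hB (.ep n) x = 1 / (2 * ((n:ℝ) + 1) + x) := by
  simp [hB, cp, cq, cr, cs, add_comm]
lemma hB_em (n : ℕ) (x : ℝ) : hB (.em n) x = 1 / (2 * ((n:ℝ) + 2) - x) := by
  simp [hB, cp, cq, cr, cs]; ring_nf
lemma hB_op (n : ℕ) (x : ℝ) : hB (.op n) x = ((n + 1) * x + (n + 2)) / ((n + 2) * x + (n + 3)) := rfl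
lemma hB_om (n : ℕ) (x : ℝ) : hB (.om n) x = ((n + 2) * x + (n + 1)) / ((n + 3) * x + (n + 2)) := rfl

lemma e_range {v : ℝ} (hv : 2 < v) : 0 < 1 / v ∧ 1 / v < 1 / 2 :=
  ⟨by positivity, one_div_lt_one_div_of_lt (by norm_num) hv⟩

lemma T_ep (n : ℕ) {t : ℝ} (h0 : 0 < t) (h1 : t < 1) :
    T (hB (.ep n) t) = t ∧ kk (hB (.ep n) t) = kB (.ep n) ∧ 0 < hB (.ep n) t ∧
      hB (.ep n) t < 1 / 2 := by
  have hn : (0 : ℝ) ≤ n := n.cast_nonneg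
  have hr := e_range (v := 2 * ((n:ℝ) + 1) + t) (by linarith)
  rw [hB_ep]
  refine ⟨?_, ?_, hr⟩
  · rw [T_e hr.1 hr.2.le, Te_of (k := n + 1) (s := t) (by linarith) h1 (by push_cast; rw [one_div_one_div]),
      abs_of_pos h0]
  · rw [kk, if_pos hr.2.le, Int.floor_eq_iff, one_div_one_div, kB]
    push_cast; constructor <;> linarith

lemma T_em (n : ℕ) {t : ℝ} (h0 : 0 < t) (h1 : t < 1) :
    T (hB (.em n) t) = t ∧ kk (hB (.em n) t) = kB (.em n) ∧ 0 < hB (.em n) t ∧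
      hB (.em n) t < 1 / 2 := by
  have hn : (0 : ℝ) ≤ n := n.cast_nonneg
  have hr := e_range (v := 2 * ((n:ℝ) + 2) - t) (by linarith)
  rw [hB_em]
  refine ⟨?_, ?_, hr⟩
  · rw [T_e hr.1 hr.2.le, Te_of (k := n + 2) (s := -t) (by linarith) (by linarith)
      (by push_cast; rw [one_div_one_div]; ring), abs_neg, abs_of_pos h0]
  · rw [kk, if_pos hr.2.le, Int.floor_eq_iff, one_div_one_div, kB]
    push_cast; constructor <;> linarith

lemma iota_range {t : ℝ} (h0 : 0 < t) (h1 : t < 1) : 0 < iota t ∧ iota t < 1 := by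
  unfold iota
  constructor
  · apply div_pos <;> linarith
  · rw [div_lt_one (by linarith)]; linarith

lemma T_op (n : ℕ) {t : ℝ} (h0 : 0 < t) (h1 : t < 1) :
    T (hB (.op n) t) = t ∧ kk (hB (.op n) t) = kB (.op n) ∧ 1 / 2 < hB (.op n) t ∧
      hB (.op n) t < 1 := by
  have hn : (0 : ℝ) ≤ n := n.cast_nonneg
  have hd : 0 < ((n:ℝ) + 2) * t + (n + 3) := by positivity
  have hr1 : 1 / 2 < hB (.op n) t := by
    rw [hB_op, lt_div_iff₀ hd]; nlinarith
  have hr2 : hB (.op n) t < 1 := by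
    rw [hB_op, div_lt_one hd]; nlinarith
  have hi := iota_range h0 h1
  refine ⟨?_, ?_, hr1, hr2⟩
  · rw [T_o hr1 hr2, Te_of (k := n + 2) (s := iota t) (by linarith) hi.2, abs_of_pos hi.1,
      iota_iota (by linarith)]
    rw [hB_op]; push_cast; unfold iota
    have e1 : 1 - ((n + 1) * t + (n + 2)) / (((n:ℝ) + 2) * t + (n + 3)) =
      (1 + t) / (((n:ℝ) + 2) * t + (n + 3)) := by field_simp; ring
    have e2 : 1 + ((n + 1) * t + (n + 2)) / (((n:ℝ) + 2) * t + (n + 3)) =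
      ((2 * n + 3) * t + (2 * n + 5)) / (((n:ℝ) + 2) * t + (n + 3)) := by field_simp; ring
    rw [e1, e2, div_div_div_cancel_right₀ hd.ne', one_div_div]
    field_simp; ring
  · rw [kk, if_neg (by linarith), Int.floor_eq_iff, kB, hB_op]
    have e1 : 1 - ((n + 1) * t + (n + 2)) / (((n:ℝ) + 2) * t + (n + 3)) =
      (1 + t) / (((n:ℝ) + 2) * t + (n + 3)) := by field_simp; ring
    rw [e1, one_div_div, le_div_iff₀ (by linarith), div_lt_iff₀ (by linarith)]
    push_cast; constructor <;> nlinarith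

lemma T_om (n : ℕ) {t : ℝ} (h0 : 0 < t) (h1 : t < 1) :
    T (hB (.om n) t) = t ∧ kk (hB (.om n) t) = kB (.om n) ∧ 1 / 2 < hB (.om n) t ∧
      hB (.om n) t < 1 := by
  have hn : (0 : ℝ) ≤ n := n.cast_nonneg
  have hd : 0 < ((n:ℝ) + 3) * t + (n + 2) := by positivity
  have hr1 : 1 / 2 < hB (.om n) t := by
    rw [hB_om, lt_div_iff₀ hd]; nlinarith
  have hr2 : hB (.om n) t < 1 := by
    rw [hB_om, div_lt_one hd]; nlinarith
  have hi := iota_range h0 h1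
  refine ⟨?_, ?_, hr1, hr2⟩
  · rw [T_o hr1 hr2, Te_of (k := n + 2) (s := -iota t) (by linarith) (by linarith), abs_neg,
      abs_of_pos hi.1, iota_iota (by linarith)]
    rw [hB_om]; push_cast; unfold iota
    have e1 : 1 - ((n + 2) * t + (n + 1)) / (((n:ℝ) + 3) * t + (n + 2)) =
      (1 + t) / (((n:ℝ) + 3) * t + (n + 2)) := by field_simp; ring
    have e2 : 1 + ((n + 2) * t + (n + 1)) / (((n:ℝ) + 3) * t + (n + 2)) =
      ((2 * n + 5) * t + (2 * n + 3)) / (((n:ℝ) + 3) * t + (n + 2)) := by field_simp; ring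
    rw [e1, e2, div_div_div_cancel_right₀ hd.ne', one_div_div]
    field_simp; ring
  · rw [kk, if_neg (by linarith), Int.floor_eq_iff, kB, hB_om]
    have e1 : 1 - ((n + 2) * t + (n + 1)) / (((n:ℝ) + 3) * t + (n + 2)) =
      (1 + t) / (((n:ℝ) + 3) * t + (n + 2)) := by field_simp; ring
    rw [e1, one_div_div, le_div_iff₀ (by linarith), div_lt_iff₀ (by linarith)]
    push_cast; constructor <;> nlinarith

lemma T_hB (d : Br) {t : ℝ} (h0 : 0 < t) (h1 : t < 1) : T (hB d t) = t := by
  cases d with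
  | ep n => exact (T_ep n h0 h1).1
  | em n => exact (T_em n h0 h1).1
  | op n => exact (T_op n h0 h1).1
  | om n => exact (T_om n h0 h1).1

lemma kk_hB (d : Br) {t : ℝ} (h0 : 0 < t) (h1 : t < 1) : kk (hB d t) = kB d := by
  cases d with
  | ep n => exact (T_ep n h0 h1).2.1
  | em n => exact (T_em n h0 h1).2.1
  | op n => exact (T_op n h0 h1).2.1
  | om n => exact (T_om n h0 h1).2.1

lemma hB_range (d : Br) {t : ℝ} (h0 : 0 < t) (h1 : t < 1) : hB d t ∈ Ioo (0:ℝ) 1 := by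
  cases d with
  | ep n => obtain ⟨-, -, x, y⟩ := T_ep n h0 h1; constructor <;> linarith
  | em n => obtain ⟨-, -, x, y⟩ := T_em n h0 h1; constructor <;> linarith
  | op n => obtain ⟨-, -, x, y⟩ := T_op n h0 h1; constructor <;> linarith
  | om n => obtain ⟨-, -, x, y⟩ := T_om n h0 h1; constructor <;> linarith

/-- an auxiliary code which distinguishes the branches -/
noncomputable def eB : Br → ℝ
  | .ep _ => 1 | .em _ => -1 | .op _ => 1 | .om _ => -1

lemma hB_disj {d e : Br} {t s : ℝ} (ht : t ∈ Ioo (0:ℝ) 1) (hs : s ∈ Ioo (0:ℝ) 1)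
    (hde : hB d t = hB e s) : d = e := by
  have hts : t = s := by rw [← T_hB d ht.1 ht.2, hde, T_hB e hs.1 hs.2]
  subst hts
  have hk : kB d = kB e := by rw [← kk_hB d ht.1 ht.2, hde, kk_hB e hs.1 hs.2]
  obtain ⟨h0, h1⟩ := ht
  cases d with
  | ep n =>
    cases e with
    | ep m => simp only [kB] at hk; congr 1; omega
    | em m =>
      rw [hB_ep, hB_em] at hde
      simp only [kB] at hk
      have : (n : ℝ) + 1 = m + 2 := by exact_mod_cast hk
      rw [this, one_div, one_div, inv_inj] at hde; linarith
    | op m => have := T_ep n h0 h1; have := T_op m h0 h1; linarith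
    | om m => have := T_ep n h0 h1; have := T_om m h0 h1; linarith
  | em n =>
    cases e with
    | ep m =>
      rw [hB_ep, hB_em] at hde
      simp only [kB] at hk
      have : (n : ℝ) + 2 = m + 1 := by exact_mod_cast hk
      rw [this, one_div, one_div, inv_inj] at hde; linarith
    | em m => simp only [kB] at hk; congr 1; omega
    | op m => have := T_em n h0 h1; have := T_op m h0 h1; linarith
    | om m => have := T_em n h0 h1; have := T_om m h0 h1; linarith
  | op n =>
    cases e with
    | ep m => have := T_op n h0 h1; have := T_ep m h0 h1; linarith
    | em m => have := T_op n h0 h1; have := T_em m h0 h1; linarith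
    | op m => simp only [kB] at hk; congr 1; omega
    | om m =>
      simp only [kB] at hk
      have : n = m := by omega
      subst this
      rw [hB_op, hB_om, div_eq_div_iff (by positivity) (by positivity)] at hde
      nlinarith
  | om n =>
    cases e with
    | ep m => have := T_om n h0 h1; have := T_ep m h0 h1; linarith
    | em m => have := T_om n h0 h1; have := T_em m h0 h1; linarith
    | op m =>
      simp only [kB] at hk
      have : n = m := by omega
      subst this
      rw [hB_op, hB_om, div_eq_div_iff (by positivity) (by positivity)] at hde
      nlinarith
    | om m => simp only [kB] at hk; congr 1; omega

/-- two-sided decomposition of an irrational number `v > 1` with respect to even integers -/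
lemma even_decomp {v : ℝ} (hv : 1 < v) (hirr : Irrational v) :
    (∃ (n : ℕ) (s : ℝ), 0 < s ∧ s < 1 ∧ v = 2 * (n + 1) + s) ∨
    (∃ (n : ℕ) (s : ℝ), 0 < s ∧ s < 1 ∧ v = 2 * (n + 1) - s) := by
  set k := ⌊(v + 1) / 2⌋ with hk
  have h1 : (k : ℝ) ≤ (v + 1) / 2 := Int.floor_le _
  have h2 : (v + 1) / 2 < k + 1 := Int.lt_floor_add_one _
  have hk1 : 1 ≤ k := by rw [hk, Int.le_floor]; push_cast; linarith
  obtain ⟨n, hn⟩ : ∃ n : ℕ, k = n + 1 := ⟨(k - 1).toNat, by omega⟩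
  have hkn : (k : ℝ) = n + 1 := by rw [hn]; push_cast; ring
  rw [hkn] at h1 h2
  have hne1 : v ≠ 2 * ((n:ℝ) + 1) := by
    have := hirr.ne_nat (2 * (n + 1)); push_cast at this; exact this
  have hne2 : v ≠ 2 * ((n:ℝ) + 1) - 1 := by
    have := hirr.ne_nat (2 * n + 1); push_cast at this; intro h; apply this; rw [h]; ring
  rcases lt_or_gt_of_ne hne1 with h | h
  · right
    refine ⟨n, 2 * (n + 1) - v, by linarith, ?_, by ring⟩
    have : 2 * ((n:ℝ) + 1) - 1 ≤ v := by linarith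
    have := lt_of_le_of_ne this (Ne.symm hne2)
    linarith
  · left
    exact ⟨n, v - 2 * (n + 1), by linarith, by linarith, by ring⟩

lemma hB_surj {x : ℝ} (hx : x ∈ Ioo (0:ℝ) 1) (hirr : Irrational x) :
    ∃ d, ∃ t ∈ Ioo (0:ℝ) 1, hB d t = x := by
  obtain ⟨h0, h1⟩ := hx
  have hne : x ≠ 1 / 2 := by
    have := hirr.ne_rat (1/2); push_cast at this; exact this
  rcases lt_or_gt_of_ne hne with hx | hx
  · have hv : 2 < 1 / x := by rw [lt_div_iff₀ h0]; linarith
    have hi : Irrational (1 / x) := by rw [one_div]; exact hirr.inv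
    rcases even_decomp (by linarith) hi with ⟨n, s, hs0, hs1, h⟩ | ⟨n, s, hs0, hs1, h⟩
    · exact ⟨.ep n, s, ⟨hs0, hs1⟩, by rw [hB_ep, ← h, one_div_one_div]⟩
    · have hn : n ≠ 0 := by rintro rfl; norm_num at h; rw [one_div] at hv; linarith
      obtain ⟨m, rfl⟩ := Nat.exists_eq_succ_of_ne_zero hn
      refine ⟨.em m, s, ⟨hs0, hs1⟩, ?_⟩
      push_cast at h
      rw [hB_em, show 2 * ((m:ℝ) + 2) - s = 1 / x by rw [h]; ring, one_div_one_div]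
  · have h1x : 0 < 1 - x := by linarith
    have e : (1 + x) / (1 - x) = 2 * (1 - x)⁻¹ - 1 := by field_simp; ring
    have hi : Irrational ((1 + x) / (1 - x)) := by
      rw [e]
      have h3 : Irrational (1 - x)⁻¹ := by
        have := (hirr.natCast_sub 1).inv
        simpa using this
      have h4 := (h3.natCast_mul (m := 2) (by norm_num)).sub_natCast 1
      simpa using h4
    have hv : 3 < (1 + x) / (1 - x) := by rw [lt_div_iff₀ h1x]; linarith
    rcases even_decomp (by linarith) hi with ⟨n, s, hs0, hs1, h⟩ | ⟨n, s, hs0, hs1, h⟩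
    · have hn : n ≠ 0 := by rintro rfl; norm_num at h; linarith
      obtain ⟨m, rfl⟩ := Nat.exists_eq_succ_of_ne_zero hn
      refine ⟨.op m, iota s, iota_range hs0 hs1, ?_⟩
      have hr := iota_range hs0 hs1
      push_cast at h
      rw [div_eq_iff h1x.ne'] at h
      rw [hB_op, div_eq_iff (by have := hr.1; positivity)]
      unfold iota
      field_simp
      linear_combination -h
    · have hn : n ≠ 0 := by rintro rfl; norm_num at h; linarith
      obtain ⟨m, rfl⟩ := Nat.exists_eq_succ_of_ne_zero hn
      refine ⟨.om m, iota s, iota_range hs0 hs1, ?_⟩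
      have hr := iota_range hs0 hs1
      push_cast at h
      rw [div_eq_iff h1x.ne'] at h
      rw [hB_om, div_eq_iff (by have := hr.1; positivity)]
      unfold iota
      field_simp
      linear_combination -h

lemma hB_hasDeriv (d : Br) {x : ℝ} (h0 : 0 ≤ x) (h1 : x ≤ 1) :
    HasDerivAt (hB d) ((cp d * cs d - cq d * cr d) / (cr d * x + cs d) ^ 2) x := by
  have hd := (den_pos d h0 h1).ne'
  have e1 : HasDerivAt (fun x => cp d * x + cq d) (cp d) x := by
    simpa using ((hasDerivAt_id x).const_mul (cp d)).add_const (cq d)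
  have e2 : HasDerivAt (fun x => cr d * x + cs d) (cr d) x := by
    simpa using ((hasDerivAt_id x).const_mul (cr d)).add_const (cs d)
  have e3 := e1.fun_div e2 hd
  refine HasDerivAt.congr_deriv e3 ?_
  ring


lemma measurable_iota : Measurable iota := by unfold iota; fun_prop

lemma measurable_Te : Measurable Te := by
  unfold Te
  have h1 : Measurable fun y : ℝ => ⌊(1 / y + 1) / 2⌋ := by fun_prop
  have h2 : Measurable fun y : ℝ => ((⌊(1 / y + 1) / 2⌋ : ℤ) : ℝ) :=
    (measurable_from_top (f := fun n : ℤ => (n : ℝ))).comp h1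
  exact ((measurable_const.div measurable_id).sub (measurable_const.mul h2)).abs

lemma measurable_T : Measurable T := by
  unfold T
  refine Measurable.ite measurableSet_Iic measurable_const ?_
  refine Measurable.ite measurableSet_Ici measurable_const ?_
  exact Measurable.ite measurableSet_Iic measurable_Te
    (measurable_iota.comp (measurable_Te.comp measurable_iota))

lemma measurable_kk : Measurable kk := by
  unfold kk
  refine Measurable.ite measurableSet_Iic ?_ ?_ <;> fun_prop

lemma volume_not_irr : volume {x : ℝ | ¬ Irrational x} = 0 := by
  have : {x : ℝ | ¬ Irrational x} = range ((↑) : ℚ → ℝ) := by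
    ext x; simp [Irrational]
  rw [this]
  exact (countable_range _).measure_zero _

lemma hB_injOn (d : Br) : InjOn (hB d) (Ioo 0 1) := by
  intro t ht s hs h
  rw [← T_hB d ht.1 ht.2, h, T_hB d hs.1 hs.2]

lemma hB_image (d : Br) (B : Set ℝ) :
    hB d '' (B ∩ Ioo 0 1) = hB d '' (Ioo 0 1) ∩ T ⁻¹' B := by
  ext x; constructor
  · rintro ⟨t, ⟨hB, ht⟩, rfl⟩
    refine ⟨⟨t, ht, rfl⟩, ?_⟩
    rw [mem_preimage, T_hB d ht.1 ht.2]; exact hB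
  · rintro ⟨⟨t, ht, rfl⟩, h⟩
    rw [mem_preimage, T_hB d ht.1 ht.2] at h
    exact ⟨t, ⟨h, ht⟩, rfl⟩

lemma branch_lintegral (d : Br) {B : Set ℝ} (hBm : MeasurableSet B) (g : ℝ → ENNReal) :
    ∫⁻ x in hB d '' (B ∩ Ioo 0 1), g x =
      ∫⁻ t in B ∩ Ioo 0 1, ENNReal.ofReal (1 / (cr d * t + cs d) ^ 2) * g (hB d t) := by
  have hm : MeasurableSet (B ∩ Ioo (0:ℝ) 1) := hBm.inter measurableSet_Ioo
  rw [lintegral_image_eq_lintegral_abs_deriv_mul hm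
    (fun x hx => (hB_hasDeriv d hx.2.1.le hx.2.2.le).hasDerivWithinAt)
    ((hB_injOn d).mono inter_subset_right)]
  refine setLIntegral_congr_fun hm ?_
  intro x hx
  simp only [abs_div, det_abs, abs_pow, sq_abs]

lemma branch_meas (d : Br) {B : Set ℝ} (hBm : MeasurableSet B) :
    MeasurableSet (hB d '' (B ∩ Ioo 0 1)) := by
  have hm : MeasurableSet (B ∩ Ioo (0:ℝ) 1) := hBm.inter measurableSet_Ioo
  exact measurable_image_of_fderivWithin hm
    (fun x hx => (hB_hasDeriv d hx.2.1.le hx.2.2.le).hasDerivWithinAt.hasFDerivWithinAt)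
    ((hB_injOn d).mono inter_subset_right)

open Classical in
/-- Decomposition of an integral along the branches. -/
lemma key (g : ℝ → ENNReal) (J : Set ℤ) {B : Set ℝ} (hBm : MeasurableSet B) :
    ∫⁻ x in (kk ⁻¹' J ∩ T ⁻¹' B) ∩ Ioo 0 1, g x =
      ∑' d, if kB d ∈ J then
        ∫⁻ t in B ∩ Ioo 0 1, ENNReal.ofReal (1 / (cr d * t + cs d) ^ 2) * g (hB d t) else 0 := by
  set S : Br → Set ℝ := fun d => if kB d ∈ J then hB d '' (B ∩ Ioo 0 1) else ∅ with hS
  have hSm : ∀ d, MeasurableSet (S d) := by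
    intro d; simp only [hS]; split_ifs
    · exact branch_meas d hBm
    · exact MeasurableSet.empty
  have hdisj : Pairwise (Function.onFun Disjoint S) := by
    intro d e hde
    rw [Function.onFun, Set.disjoint_left]
    intro x hx hy
    simp only [hS] at hx hy
    split_ifs at hx hy
    · obtain ⟨t, ht, rfl⟩ := hx
      obtain ⟨s, hs, h⟩ := hy
      exact hde (hB_disj ht.2 hs.2 h.symm)
    all_goals simp_all
  have hae : ((kk ⁻¹' J ∩ T ⁻¹' B) ∩ Ioo 0 1 : Set ℝ) =ᵐ[volume] ⋃ d, S d := by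
    have : ∀ᵐ x : ℝ, Irrational x := by rw [ae_iff]; exact volume_not_irr
    filter_upwards [this] with x hx
    apply propext
    change (x ∈ ((kk ⁻¹' J ∩ T ⁻¹' B) ∩ Ioo 0 1 : Set ℝ)) ↔ x ∈ (⋃ d, S d)
    rw [mem_iUnion]
    constructor
    · rintro ⟨⟨h1, h2⟩, h3⟩
      obtain ⟨d, t, ht, rfl⟩ := hB_surj h3 hx
      rw [mem_preimage, kk_hB d ht.1 ht.2] at h1
      rw [mem_preimage, T_hB d ht.1 ht.2] at h2
      refine ⟨d, ?_⟩
      simp only [hS, if_pos h1]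
      exact ⟨t, ⟨h2, ht⟩, rfl⟩
    · rintro ⟨d, hd⟩
      simp only [hS] at hd
      split_ifs at hd with hJ
      · obtain ⟨t, ht, rfl⟩ := hd
        refine ⟨⟨?_, ?_⟩, hB_range d ht.2.1 ht.2.2⟩
        · rw [mem_preimage, kk_hB d ht.2.1 ht.2.2]; exact hJ
        · rw [mem_preimage, T_hB d ht.2.1 ht.2.2]; exact ht.1
      · exact absurd hd (notMem_empty _)
  rw [setLIntegral_congr hae, lintegral_iUnion hSm hdisj]
  congr 1; ext d
  simp only [hS]
  split_ifs
  · exact branch_lintegral d hBm g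
  · simp

/-! ### Relation with the digits -/

lemma T_irr {x : ℝ} (hx : x ∈ Ioo (0:ℝ) 1) (hirr : Irrational x) :
    T x ∈ Ioo (0:ℝ) 1 ∧ Irrational (T x) := by
  obtain ⟨d, t, ht, rfl⟩ := hB_surj hx hirr
  rw [T_hB d ht.1 ht.2]
  refine ⟨ht, ?_⟩
  rintro ⟨q, rfl⟩
  apply hirr
  have hc : ∀ d : Br, ∃ p q r s : ℚ, cp d = p ∧ cq d = q ∧ cr d = r ∧ cs d = s := by
    intro d
    cases d with
    | ep n => exact ⟨0, 1, 1, 2 * (n + 1), by simp [cp], by simp [cq], by simp [cr], by simp [cs]⟩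
    | em n => exact ⟨0, 1, -1, 2 * (n + 2), by simp [cp], by simp [cq], by simp [cr], by simp [cs]⟩
    | op n => exact ⟨n + 1, n + 2, n + 2, n + 3, by simp [cp], by simp [cq], by simp [cr], by simp [cs]⟩
    | om n => exact ⟨n + 2, n + 1, n + 3, n + 2, by simp [cp], by simp [cq], by simp [cr], by simp [cs]⟩
  obtain ⟨p, q', r, s, h1, h2, h3, h4⟩ := hc d
  refine ⟨(p * q + q') / (r * q + s), ?_⟩
  rw [hB, h1, h2, h3, h4]; push_cast; rfl

lemma T_iter_irr {x : ℝ} (hx : x ∈ Ioo (0:ℝ) 1) (hirr : Irrational x) (n : ℕ) :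
    T^[n] x ∈ Ioo (0:ℝ) 1 ∧ Irrational (T^[n] x) := by
  induction n with
  | zero => exact ⟨hx, hirr⟩
  | succ n ih => rw [Function.iterate_succ_apply']; exact T_irr ih.1 ih.2

lemma branch_kk {d : Digit} (hd : d.Valid) {x : ℝ} (hx : x ∈ branch d) (hirr : Irrational x) :
    d.a = kk x := by
  obtain ⟨k, e, s⟩ := d
  have hk1 : 1 ≤ k := by rcases hd with ⟨h, -⟩ | ⟨h, -⟩ <;> simp only at h <;> omega
  have hk1' : (1 : ℝ) ≤ k := by exact_mod_cast hk1
  cases s with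
  | e =>
    have key : 1 / (2 * (k:ℝ) + 1) ≤ x → x < 1 / (2 * (k:ℝ) - 1) → x ≤ 1 / 2 → k = kk x := by
      intro h1 h2 h3
      have h0 : 0 < x := lt_of_lt_of_le (by positivity) h1
      symm
      rw [kk, if_pos h3, Int.floor_eq_iff]
      have hne : x ≠ 1 / (2 * (k:ℝ) + 1) := by
        have := hirr.ne_rat (1 / (2 * k + 1)); push_cast at this; exact this
      have h1' := lt_of_le_of_ne h1 (Ne.symm hne)
      rw [div_lt_iff₀ (by linarith)] at h1'
      rw [lt_div_iff₀ (by linarith)] at h2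
      have e1 : 2 * (k:ℝ) - 1 < 1 / x := by rw [lt_div_iff₀ h0]; linarith
      have e2 : 1 / x < 2 * (k:ℝ) + 1 := by rw [div_lt_iff₀ h0]; linarith
      constructor <;> linarith
    simp only [branch] at hx
    split_ifs at hx with h1 h2
    · subst h1
      refine key ?_ ?_ hx.2
      · have := hx.1; norm_num at *; exact this
      · have := hx.2; norm_num at *; linarith
    · have hk2 : 2 ≤ k := by omega
      have hk2' : (2 : ℝ) ≤ k := by exact_mod_cast hk2
      have l1 : 1 / (2 * (k:ℝ)) ≤ 1 / (2 * (k:ℝ) - 1) :=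
        one_div_le_one_div_of_le (by linarith) (by linarith)
      have l2 : 1 / (2 * (k:ℝ)) ≤ 1 / 2 := one_div_le_one_div_of_le (by linarith) (by linarith)
      exact key hx.1 (lt_of_lt_of_le hx.2 l1) (by linarith [hx.2])
    · have hk2 : 2 ≤ k := by omega
      have hk2' : (2 : ℝ) ≤ k := by exact_mod_cast hk2
      have l1 : 1 / (2 * (k:ℝ) + 1) ≤ 1 / (2 * (k:ℝ)) :=
        one_div_le_one_div_of_le (by linarith) (by linarith)
      have l2 : 1 / (2 * (k:ℝ) - 1) ≤ 1 / 2 := one_div_le_one_div_of_le (by linarith) (by linarith)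
      exact key (l1.trans hx.1) hx.2 (by linarith [hx.2])
  | o =>
    have hk2 : 2 ≤ k := by
      rcases hd with ⟨h, -⟩ | ⟨-, -, h⟩
      · exact h
      · cases h
    have hk2' : (2 : ℝ) ≤ k := by exact_mod_cast hk2
    have key : ((k:ℝ) - 1) / k < x → x ≤ (k:ℝ) / (k + 1) → k = kk x := by
      intro h1 h2
      have hne : x ≠ (k:ℝ) / (k + 1) := by
        have := hirr.ne_rat (k / (k + 1)); push_cast at this; exact this
      have h2' := lt_of_le_of_ne h2 hne
      rw [div_lt_iff₀ (by linarith)] at h1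
      rw [lt_div_iff₀ (by linarith)] at h2'
      have hx1 : x < 1 := by nlinarith
      have hx2 : 1 / 2 < x := by nlinarith
      symm
      rw [kk, if_neg (by linarith), Int.floor_eq_iff, le_div_iff₀ (by linarith),
        div_lt_iff₀ (by linarith)]
      constructor <;> nlinarith
    have m1 : ((k:ℝ) - 1) / k ≤ (2 * k - 1) / (2 * k + 1) := by
      rw [div_le_div_iff₀ (by linarith) (by linarith)]; nlinarith
    have m2 : (2 * (k:ℝ) - 1) / (2 * k + 1) ≤ k / (k + 1) := by
      rw [div_le_div_iff₀ (by linarith) (by linarith)]; nlinarith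
    simp only [branch] at hx
    split_ifs at hx with h1
    · exact key (lt_of_le_of_lt m1 hx.1) hx.2
    · exact key hx.1 (hx.2.trans m2)

lemma exists_digit {x : ℝ} (hx : x ∈ Ioo (0:ℝ) 1) (hirr : Irrational x) :
    ∃ d : Digit, d.Valid ∧ x ∈ branch d := by
  obtain ⟨d, t, ⟨h0, h1⟩, rfl⟩ := hB_surj hx hirr
  cases d with
  | ep n =>
    have hn : (0:ℝ) ≤ n := n.cast_nonneg
    rcases Nat.eq_zero_or_pos n with rfl | hpos
    · refine ⟨⟨1, 1, .e⟩, by simp [Digit.Valid], ?_⟩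
      simp only [branch, if_true, hB_ep]
      constructor
      · apply one_div_le_one_div_of_le <;> norm_num <;> linarith
      · apply one_div_le_one_div_of_le <;> norm_num; linarith
    · refine ⟨⟨n + 1, 1, .e⟩, Or.inl ⟨by simp; omega, by simp⟩, ?_⟩
      have : (n : ℤ) + 1 ≠ 1 := by omega
      simp only [branch, if_true, hB_ep, if_neg this]
      push_cast
      constructor
      · apply one_div_le_one_div_of_le <;> linarith
      · apply one_div_lt_one_div_of_lt <;> linarith
  | em n =>
    have hn : (0:ℝ) ≤ n := n.cast_nonneg
    refine ⟨⟨n + 2, -1, .e⟩, Or.inl ⟨by simp, by simp⟩, ?_⟩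
    have : (n : ℤ) + 2 ≠ 1 := by omega
    have h' : (-1 : ℤ) ≠ 1 := by decide
    simp only [branch, if_neg h', hB_em, if_neg this]
    push_cast
    constructor
    · apply one_div_le_one_div_of_le <;> linarith
    · apply one_div_lt_one_div_of_lt <;> linarith
  | op n =>
    have hn : (0:ℝ) ≤ n := n.cast_nonneg
    refine ⟨⟨n + 2, 1, .o⟩, Or.inl ⟨by simp, by simp⟩, ?_⟩
    simp only [branch, if_true, hB_op]
    push_cast
    constructor
    · rw [div_lt_div_iff₀ (by positivity) (by positivity)]; nlinarith
    · rw [div_le_div_iff₀ (by positivity) (by positivity)]; nlinarith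
  | om n =>
    have hn : (0:ℝ) ≤ n := n.cast_nonneg
    refine ⟨⟨n + 2, -1, .o⟩, Or.inl ⟨by simp, by simp⟩, ?_⟩
    have h' : (-1 : ℤ) ≠ 1 := by decide
    simp only [branch, if_neg h', hB_om]
    push_cast
    constructor
    · rw [div_lt_div_iff₀ (by positivity) (by positivity)]; nlinarith
    · rw [div_le_div_iff₀ (by positivity) (by positivity)]; nlinarith

lemma digit_a {x : ℝ} (hx : x ∈ Ioo (0:ℝ) 1) (hirr : Irrational x) : (digit x).a = kk x := by
  have hex := exists_digit hx hirr
  rw [digit, dif_pos hex]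
  exact branch_kk hex.choose_spec.1 hex.choose_spec.2 hirr

/-- no exceedance of level `c` among the first `n` digits -/
def S (c : ℝ) (n : ℕ) : Set ℝ := {x | ∀ i < n, (kk (T^[i] x) : ℝ) ≤ c}

lemma U_eq (c : ℝ) (n : ℕ) : {x : ℝ | x ∈ Set.Ioo (0 : ℝ) 1 ∧ Irrational x ∧
    ∀ i : ℕ, 1 ≤ i → i ≤ n → (a i x : ℝ) ≤ c} = (Ioo 0 1 ∩ {x | Irrational x}) ∩ S c n := by
  ext x
  constructor
  · rintro ⟨h1, h2, h3⟩
    refine ⟨⟨h1, h2⟩, fun i hi => ?_⟩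
    have := h3 (i + 1) (by omega) (by omega)
    have hT := T_iter_irr h1 h2 i
    rwa [a, dig, Nat.add_sub_cancel, digit_a hT.1 hT.2] at this
  · rintro ⟨⟨h1, h2⟩, h3⟩
    refine ⟨h1, h2, fun i hi hin => ?_⟩
    have := h3 (i - 1) (by omega)
    have hT := T_iter_irr h1 h2 (i - 1)
    rwa [a, dig, digit_a hT.1 hT.2]


/-! ### The family of Möbius densities and the dual chain -/

noncomputable def kd (u x : ℝ) : ℝ := u / (1 - x + u * x) ^ 2

noncomputable def Pm (u : ℝ) : Measure ℝ :=
  (volume.restrict (Ioo (0 : ℝ) 1)).withDensity fun x => ENNReal.ofReal (kd u x)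

lemma wd_apply (f : ℝ → ENNReal) {B : Set ℝ} (hB : MeasurableSet B) :
    ((volume.restrict (Ioo (0 : ℝ) 1)).withDensity f) B = ∫⁻ x in B ∩ Ioo 0 1, f x := by
  rw [withDensity_apply _ hB, Measure.restrict_restrict hB]

lemma Pm_apply (u : ℝ) {B : Set ℝ} (hB : MeasurableSet B) :
    Pm u B = ∫⁻ x in B ∩ Ioo 0 1, ENNReal.ofReal (kd u x) := wd_apply _ hB

lemma kd_den_pos {u x : ℝ} (hu : 0 < u) (h0 : 0 ≤ x) (h1 : x ≤ 1) : 0 < 1 - x + u * x := by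
  rcases eq_or_lt_of_le h0 with rfl | h
  · simp
  · have := mul_pos hu h; linarith

/-- mass of an interval in terms of a primitive -/
lemma lint_ftc {F f : ℝ → ℝ} {x y : ℝ} (hxy : x ≤ y)
    (hF : ∀ t ∈ Icc x y, HasDerivAt F (f t) t) (hc : ContinuousOn f (Icc x y))
    (h0 : ∀ t ∈ Icc x y, 0 ≤ f t) :
    ∫⁻ t in Ioo x y, ENNReal.ofReal (f t) = ENNReal.ofReal (F y - F x) := by
  have hfi : IntervalIntegrable f volume x y := by
    apply ContinuousOn.intervalIntegrable; rwa [uIcc_of_le hxy]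
  have h1 : ∫ t in x..y, f t = F y - F x := by
    apply intervalIntegral.integral_eq_sub_of_hasDerivAt _ hfi
    rwa [uIcc_of_le hxy]
  rw [intervalIntegral.integral_of_le hxy] at h1
  rw [setLIntegral_congr Ioo_ae_eq_Ioc, ← h1, ofReal_integral_eq_lintegral_ofReal]
  · exact (intervalIntegrable_iff_integrableOn_Ioc_of_le hxy).1 hfi
  · rw [EventuallyLE, ae_restrict_iff' measurableSet_Ioc]
    exact Eventually.of_forall fun t ht => h0 t (Ioc_subset_Icc_self ht)

lemma Pm_univ {u : ℝ} (hu : 0 < u) : Pm u univ = 1 := by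
  rw [Pm_apply u MeasurableSet.univ, univ_inter]
  have hF : ∀ t ∈ Icc (0:ℝ) 1, HasDerivAt (fun t => u * t / (1 - t + u * t)) (kd u t) t := by
    intro t ht
    have hd := (kd_den_pos hu ht.1 ht.2).ne'
    have e1 : HasDerivAt (fun t => u * t) u t := by simpa using (hasDerivAt_id t).const_mul u
    have e2 : HasDerivAt (fun t => 1 - t + u * t) (-1 + u) t := by
      exact ((hasDerivAt_id t).const_sub 1).add e1
    refine (e1.fun_div e2 hd).congr_deriv ?_
    unfold kd; congr 1; ring
  rw [lint_ftc (F := fun t => u * t / (1 - t + u * t)) zero_le_one hF]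
  · simp [hu.ne']
  · unfold kd
    apply ContinuousOn.div (by fun_prop) (by fun_prop)
    intro t ht; exact pow_ne_zero 2 (kd_den_pos hu ht.1 ht.2).ne'
  · intro t ht; unfold kd; positivity

instance (u : ℝ) : IsFiniteMeasure (Pm u) := by
  by_cases hu : 0 < u
  · exact ⟨by rw [Pm_univ hu]; exact ENNReal.one_lt_top⟩
  · have : Pm u = 0 := by
      unfold Pm
      have : (fun x => ENNReal.ofReal (kd u x)) = 0 := by
        ext x; simp only [Pi.zero_apply, ENNReal.ofReal_eq_zero]; unfold kd
        exact div_nonpos_of_nonpos_of_nonneg (not_lt.1 hu) (sq_nonneg _)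
      rw [this, withDensity_zero]
    rw [this]; infer_instance

noncomputable def al (d : Br) (u : ℝ) : ℝ := cq d * u + (cs d - cq d)
noncomputable def be (d : Br) (u : ℝ) : ℝ := (cp d + cq d) * u + (cr d + cs d - cp d - cq d)
noncomputable def ww (d : Br) (u : ℝ) : ℝ := u / (al d u * be d u)
noncomputable def Hd (d : Br) (u : ℝ) : ℝ := be d u / al d u

lemma coef_pos (d : Br) : 0 < cq d ∧ 0 < cs d - cq d ∧ 0 < cp d + cq d ∧
    0 < cr d + cs d - cp d - cq d := by
  cases d with
  | ep n => have : (0:ℝ) ≤ n := n.cast_nonneg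
            simp only [cp, cq, cr, cs]; refine ⟨?_, ?_, ?_, ?_⟩ <;> linarith
  | em n => have : (0:ℝ) ≤ n := n.cast_nonneg
            simp only [cp, cq, cr, cs]; refine ⟨?_, ?_, ?_, ?_⟩ <;> linarith
  | op n => have : (0:ℝ) ≤ n := n.cast_nonneg
            simp only [cp, cq, cr, cs]; refine ⟨?_, ?_, ?_, ?_⟩ <;> linarith
  | om n => have : (0:ℝ) ≤ n := n.cast_nonneg
            simp only [cp, cq, cr, cs]; refine ⟨?_, ?_, ?_, ?_⟩ <;> linarith

lemma al_pos (d : Br) {u : ℝ} (hu : 0 < u) : 0 < al d u := by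
  obtain ⟨h1, h2, -, -⟩ := coef_pos d; unfold al; positivity
lemma be_pos (d : Br) {u : ℝ} (hu : 0 < u) : 0 < be d u := by
  obtain ⟨-, -, h1, h2⟩ := coef_pos d; unfold be; positivity
lemma ww_pos (d : Br) {u : ℝ} (hu : 0 < u) : 0 < ww d u := by
  have := al_pos d hu; have := be_pos d hu; unfold ww; positivity
lemma Hd_pos (d : Br) {u : ℝ} (hu : 0 < u) : 0 < Hd d u := by
  have := al_pos d hu; have := be_pos d hu; unfold Hd; positivity

/-- the parameter interval -/
def Y : Set ℝ := Icc (2/3) (11/4)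

lemma Y_pos {u : ℝ} (hu : u ∈ Y) : 0 < u := lt_of_lt_of_le (by norm_num) hu.1

lemma Hd_mem (d : Br) {u : ℝ} (hu : u ∈ Y) : Hd d u ∈ Y := by
  have h0 := Y_pos hu
  have hal := al_pos d h0
  obtain ⟨h1, h2⟩ := hu
  have : 2 / 3 * al d u ≤ be d u ∧ be d u ≤ 11 / 4 * al d u := by
    cases d with
    | ep n => have : (0:ℝ) ≤ n := n.cast_nonneg
              simp only [al, be, cp, cq, cr, cs]; constructor <;> nlinarith
    | em n => have : (0:ℝ) ≤ n := n.cast_nonneg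
              simp only [al, be, cp, cq, cr, cs]; constructor <;> nlinarith
    | op n => have : (0:ℝ) ≤ n := n.cast_nonneg
              have : (0:ℝ) ≤ n * u := by positivity
              simp only [al, be, cp, cq, cr, cs]; constructor <;> nlinarith
    | om n => have : (0:ℝ) ≤ n := n.cast_nonneg
              have : (0:ℝ) ≤ n * u := by positivity
              simp only [al, be, cp, cq, cr, cs]; constructor <;> nlinarith
  unfold Hd Y
  exact ⟨(le_div_iff₀ hal).2 this.1, (div_le_iff₀ hal).2 this.2⟩

lemma ww_le (d : Br) {u : ℝ} (hu : 0 < u) : u ≤ 1 / 5 * (al d u * be d u) := by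
  cases d with
  | ep n => have : (0:ℝ) ≤ n := n.cast_nonneg
            have : (0:ℝ) ≤ n * u := by positivity
            simp only [al, be, cp, cq, cr, cs]; nlinarith [sq_nonneg (u - 1)]
  | em n => have : (0:ℝ) ≤ n := n.cast_nonneg
            have : (0:ℝ) ≤ n * u := by positivity
            simp only [al, be, cp, cq, cr, cs]; nlinarith [sq_nonneg (u - 1)]
  | op n => have : (0:ℝ) ≤ n := n.cast_nonneg
            have : (0:ℝ) ≤ n * u := by positivity
            have : (0:ℝ) ≤ n * u * u := by positivity
            have : (0:ℝ) ≤ n * (n * u * u) := by positivity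
            simp only [al, be, cp, cq, cr, cs]; nlinarith [sq_nonneg (u - 1)]
  | om n => have : (0:ℝ) ≤ n := n.cast_nonneg
            have : (0:ℝ) ≤ n * u := by positivity
            have : (0:ℝ) ≤ n * u * u := by positivity
            have : (0:ℝ) ≤ n * (n * u * u) := by positivity
            simp only [al, be, cp, cq, cr, cs]; nlinarith [sq_nonneg (u - 1)]

lemma kd_hB (d : Br) {u t : ℝ} (hu : 0 < u) (h0 : 0 ≤ t) (h1 : t ≤ 1) :
    1 / (cr d * t + cs d) ^ 2 * kd u (hB d t) = ww d u * kd (Hd d u) t := by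
  have hA := al_pos d hu
  have hBe := be_pos d hu
  have hden := den_pos d h0 h1
  have hX : 0 < al d u * (1 - t) + be d u * t := by
    have := kd_den_pos (Hd_pos d hu) h0 h1
    have e : al d u * (1 - t) + be d u * t = al d u * (1 - t + Hd d u * t) := by
      unfold Hd; field_simp
    rw [e]; positivity
  have e1 : 1 - hB d t + u * hB d t = (al d u * (1 - t) + be d u * t) / (cr d * t + cs d) := by
    have hh : hB d t * (cr d * t + cs d) = cp d * t + cq d := by
      unfold hB; exact div_mul_cancel₀ _ hden.ne'
    rw [eq_div_iff hden.ne']; unfold al be; linear_combination (u - 1) * hh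
  have e2 : 1 - t + Hd d u * t = (al d u * (1 - t) + be d u * t) / al d u := by
    unfold Hd; field_simp
  unfold kd
  rw [e1, e2]
  unfold ww Hd
  field_simp

open Classical in
lemma Pm_step {u : ℝ} (hu : 0 < u) (J : Set ℤ) {B : Set ℝ} (hBm : MeasurableSet B) :
    Pm u (kk ⁻¹' J ∩ T ⁻¹' B) =
      ∑' d, if kB d ∈ J then ENNReal.ofReal (ww d u) * Pm (Hd d u) B else 0 := by
  rw [Pm_apply u ((measurable_kk (MeasurableSet.of_discrete)).inter (measurable_T hBm)),
    key _ _ hBm]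
  congr 1; ext d
  split_ifs
  · rw [Pm_apply _ hBm, ← lintegral_const_mul']
    · refine setLIntegral_congr_fun (hBm.inter measurableSet_Ioo) ?_
      intro t ht
      have := den_pos d ht.2.1.le ht.2.2.le
      simp only
      rw [← ENNReal.ofReal_mul (by positivity), ← ENNReal.ofReal_mul (ww_pos d hu).le,
        kd_hB d hu ht.2.1.le ht.2.2.le]
    · exact ENNReal.ofReal_ne_top
  · rfl

lemma Pm_pre {u : ℝ} (hu : 0 < u) {B : Set ℝ} (hBm : MeasurableSet B) :
    Pm u (T ⁻¹' B) = ∑' d, ENNReal.ofReal (ww d u) * Pm (Hd d u) B := by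
  have := Pm_step hu univ hBm
  simpa using this

lemma ww_hasSum {u : ℝ} (hu : 0 < u) : HasSum (fun d => ww d u) 1 := by
  have h1 := Pm_pre hu MeasurableSet.univ
  rw [preimage_univ, Pm_univ hu] at h1
  simp only [Pm_univ (Hd_pos _ hu), mul_one] at h1
  have h2 : (∑' d, ENNReal.ofReal (ww d u)) ≠ ⊤ := by rw [← h1]; exact ENNReal.one_ne_top
  have h3 := ENNReal.hasSum_toReal h2
  rw [← ENNReal.tsum_toReal_eq (fun d => ENNReal.ofReal_ne_top), ← h1] at h3
  simpa [ENNReal.toReal_ofReal (ww_pos _ hu).le] using h3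

lemma Pm_real_le {u : ℝ} (hu : 0 < u) (B : Set ℝ) : (Pm u).real B ≤ 1 := by
  rw [measureReal_def]
  apply ENNReal.toReal_le_of_le_ofReal zero_le_one
  rw [ENNReal.ofReal_one, ← Pm_univ hu]; exact measure_mono (subset_univ _)

lemma Pm_pre_real {u : ℝ} (hu : 0 < u) {B : Set ℝ} (hBm : MeasurableSet B) :
    (Pm u).real (T ⁻¹' B) = ∑' d, ww d u * (Pm (Hd d u)).real B := by
  rw [measureReal_def, Pm_pre hu hBm, ENNReal.tsum_toReal_eq]
  · simp only [ENNReal.toReal_mul, ENNReal.toReal_ofReal (ww_pos _ hu).le, measureReal_def]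
  · intro d; exact ENNReal.mul_ne_top ENNReal.ofReal_ne_top (measure_ne_top _ _)

/-! ### Contraction -/

lemma Hd_contract (d : Br) {u v : ℝ} (hv : 0 < v) (huv : v ≤ u) :
    |log (Hd d u) - log (Hd d v)| ≤ 1 / 5 * (log u - log v) := by
  have hu : 0 < u := hv.trans_le huv
  have main : ∀ σ : ℝ, |σ| = 1 → MonotoneOn
      (fun x => 1 / 5 * log x + σ * (log (be d x) - log (al d x))) (Ioi 0) := by
    intro σ hσ
    have hder : ∀ x ∈ Ioi (0:ℝ), HasDerivAt
        (fun x => 1 / 5 * log x + σ * (log (be d x) - log (al d x)))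
        (1 / 5 * x⁻¹ + σ * ((cp d + cq d) / be d x - cq d / al d x)) x := by
      intro x hx
      have hx' : 0 < x := hx
      have e1 : HasDerivAt (al d) (cq d) x := by
        unfold al; simpa using ((hasDerivAt_id x).const_mul (cq d)).add_const (cs d - cq d)
      have e2 : HasDerivAt (be d) (cp d + cq d) x := by
        unfold be; simpa using ((hasDerivAt_id x).const_mul (cp d + cq d)).add_const
          (cr d + cs d - cp d - cq d)
      exact ((hasDerivAt_log hx'.ne').const_mul _).add
        (((e2.log (be_pos d hx').ne').sub (e1.log (al_pos d hx').ne')).const_mul σ)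
    apply monotoneOn_of_deriv_nonneg (convex_Ioi 0)
    · exact fun x hx => (hder x hx).continuousAt.continuousWithinAt
    · intro x hx; rw [interior_Ioi] at hx
      exact (hder x hx).differentiableAt.differentiableWithinAt
    · intro x hx
      rw [interior_Ioi] at hx
      have hx' : 0 < x := hx
      rw [(hder x hx).deriv]
      have ha := al_pos d hx'
      have hb := be_pos d hx'
      have e : (cp d + cq d) / be d x - cq d / al d x =
          (cp d * cs d - cq d * cr d) / (al d x * be d x) := by
        rw [div_sub_div _ _ hb.ne' ha.ne', mul_comm (be d x) (al d x)]
        congr 1; unfold al be; ring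
      rw [e]
      have h1 : |σ * ((cp d * cs d - cq d * cr d) / (al d x * be d x))| ≤ 1 / 5 * x⁻¹ := by
        rw [abs_mul, hσ, abs_div, det_abs, abs_of_pos (mul_pos ha hb), one_mul,
          div_le_iff₀ (mul_pos ha hb)]
        have := ww_le d hx'
        calc (1:ℝ) = x * x⁻¹ := (mul_inv_cancel₀ hx'.ne').symm
          _ ≤ (1 / 5 * (al d x * be d x)) * x⁻¹ := by gcongr
          _ = _ := by ring
      linarith [neg_abs_le (σ * ((cp d * cs d - cq d * cr d) / (al d x * be d x)))]
  have m1 := main 1 (by simp) (show v ∈ Ioi (0:ℝ) from hv) (show u ∈ Ioi (0:ℝ) from hu) huv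
  have m2 := main (-1) (by simp) (show v ∈ Ioi (0:ℝ) from hv) (show u ∈ Ioi (0:ℝ) from hu) huv
  simp only at m1 m2
  have l : ∀ x, 0 < x → log (Hd d x) = log (be d x) - log (al d x) := fun x hx => by
    unfold Hd; rw [log_div (be_pos d hx).ne' (al_pos d hx).ne']
  rw [l u hu, l v hv, abs_le]
  constructor <;> linarith

lemma ratio_lin {A A' u v : ℝ} (hA : 0 ≤ A) (hA' : 0 ≤ A') (hv : 0 < v) (huv : v ≤ u) :
    A * v + A' ≤ A * u + A' ∧ A * u + A' ≤ u / v * (A * v + A') := by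
  constructor
  · gcongr
  · have : u / v * (A * v + A') = A * u + u / v * A' := by field_simp
    rw [this]
    have : 1 ≤ u / v := (one_le_div hv).2 huv
    nlinarith

lemma ratio_frac {X Y X' Y' u v : ℝ} (hv : 0 < v) (huv : v ≤ u) (hX : 0 < X) (hY : 0 < Y)
    (h1 : X ≤ X') (h2 : X' ≤ u / v * X) (h3 : Y ≤ Y') (h4 : Y' ≤ u / v * Y) :
    u / (X' * Y') ≤ u / v * (v / (X * Y)) ∧ v / (X * Y) ≤ u / v * (u / (X' * Y')) := by
  have hu : 0 < u := hv.trans_le huv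
  have hX' := hX.trans_le h1
  have hY' := hY.trans_le h3
  constructor
  · have : u / v * (v / (X * Y)) = u / (X * Y) := by field_simp
    rw [this]; gcongr
  · have e : v / (X * Y) = u / v * (u / ((u / v * X) * (u / v * Y))) := by field_simp
    rw [e]; gcongr

lemma ww_ratio (d : Br) {u v : ℝ} (hv : 0 < v) (huv : v ≤ u) :
    ww d u ≤ u / v * ww d v ∧ ww d v ≤ u / v * ww d u := by
  obtain ⟨h1, h2, h3, h4⟩ := coef_pos d
  have r1 := ratio_lin h1.le h2.le hv huv
  have r2 := ratio_lin h3.le h4.le hv huv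
  exact ratio_frac hv huv (al_pos d hv) (be_pos d hv) r1.1 r1.2 r2.1 r2.2

lemma kd_ratio {u v x : ℝ} (hv : 0 < v) (huv : v ≤ u) (h0 : 0 ≤ x) (h1 : x ≤ 1) :
    kd u x ≤ u / v * kd v x ∧ kd v x ≤ u / v * kd u x := by
  have r1 := ratio_lin h0 (sub_nonneg.2 h1) hv huv
  have e : ∀ w : ℝ, kd w x = w / ((x * w + (1 - x)) * (x * w + (1 - x))) := by
    intro w; unfold kd; congr 1; ring
  rw [e, e]
  have hp : 0 < x * v + (1 - x) := by have := kd_den_pos hv h0 h1; linarith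
  exact ratio_frac hv huv hp hp r1.1 r1.2 r1.1 r1.2

lemma Pm_ratio {u v : ℝ} (hv : 0 < v) (huv : v ≤ u) {B : Set ℝ} (hB : MeasurableSet B) :
    Pm u B ≤ ENNReal.ofReal (u / v) * Pm v B ∧ Pm v B ≤ ENNReal.ofReal (u / v) * Pm u B := by
  have hr : 0 ≤ u / v := by have := hv.trans_le huv; positivity
  rw [Pm_apply _ hB, Pm_apply _ hB, ← lintegral_const_mul' _ _ ENNReal.ofReal_ne_top,
    ← lintegral_const_mul' _ _ ENNReal.ofReal_ne_top]
  constructor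
  · refine setLIntegral_mono' (hB.inter measurableSet_Ioo) fun x hx => ?_
    rw [← ENNReal.ofReal_mul hr]
    exact ENNReal.ofReal_le_ofReal (kd_ratio hv huv hx.2.1.le hx.2.2.le).1
  · refine setLIntegral_mono' (hB.inter measurableSet_Ioo) fun x hx => ?_
    rw [← ENNReal.ofReal_mul hr]
    exact ENNReal.ofReal_le_ofReal (kd_ratio hv huv hx.2.1.le hx.2.2.le).2

lemma Y_ratio {u v : ℝ} (hu : u ∈ Y) (hv : v ∈ Y) : u / v ≤ 5 := by
  rw [div_le_iff₀ (Y_pos hv)]; have := hu.2; have := hv.1; linarith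

lemma Pm_le5 {u v : ℝ} (hu : u ∈ Y) (hv : v ∈ Y) {B : Set ℝ} (hB : MeasurableSet B) :
    Pm u B ≤ 5 * Pm v B := by
  have h5 : ∀ r : ℝ, r ≤ 5 → ENNReal.ofReal r ≤ 5 := fun r hr => by
    have := ENNReal.ofReal_le_ofReal hr; simpa using this
  rcases le_total v u with h | h
  · refine (Pm_ratio (Y_pos hv) h hB).1.trans ?_
    gcongr; exact h5 _ (Y_ratio hu hv)
  · refine (Pm_ratio (Y_pos hu) h hB).2.trans ?_
    gcongr; exact h5 _ (Y_ratio hv hu)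

lemma log_ratio_ge {u v : ℝ} (hv : 0 < v) (huv : v ≤ u) :
    2 * (u / v - 1) ≤ (log u - log v) * (u / v + 1) := by
  have hr : 1 ≤ u / v := (one_le_div hv).2 huv
  have := le_log_one_add_of_nonneg (x := u / v - 1) (by linarith)
  rw [show 1 + (u / v - 1) = u / v by ring, log_div (hv.trans_le huv).ne' hv.ne',
    div_le_iff₀ (by linarith)] at this
  linarith

lemma Pm_lip0 {u v : ℝ} (hu : u ∈ Y) (hv : v ∈ Y) (huv : v ≤ u) {B : Set ℝ}
    (hB : MeasurableSet B) :
    |(Pm u).real B - (Pm v).real B| ≤ 3 * (log u - log v) := by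
  have hv0 := Y_pos hv
  have hr : 1 ≤ u / v := (one_le_div hv0).2 huv
  have hr5 := Y_ratio hu hv
  have h := Pm_ratio hv0 huv hB
  have c1 : (Pm u).real B ≤ u / v * (Pm v).real B := by
    have := ENNReal.toReal_mono (ENNReal.mul_ne_top ENNReal.ofReal_ne_top (measure_ne_top _ _)) h.1
    rwa [ENNReal.toReal_mul, ENNReal.toReal_ofReal (by linarith)] at this
  have c2 : (Pm v).real B ≤ u / v * (Pm u).real B := by
    have := ENNReal.toReal_mono (ENNReal.mul_ne_top ENNReal.ofReal_ne_top (measure_ne_top _ _)) h.2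
    rwa [ENNReal.toReal_mul, ENNReal.toReal_ofReal (by linarith)] at this
  have b1 := Pm_real_le (Y_pos hu) B
  have b2 := Pm_real_le hv0 B
  have l := log_ratio_ge hv0 huv
  have l0 : 0 ≤ log u - log v := sub_nonneg.2 (log_le_log hv0 huv)
  have : u / v - 1 ≤ 3 * (log u - log v) := by nlinarith
  rw [abs_le]; constructor <;> nlinarith

lemma log_mid {z : ℝ} (hz : z ∈ Y) : |log z - log (4/3)| ≤ 3 / 4 := by
  have h0 := Y_pos hz
  have l2 := Real.log_two_lt_d9
  have a1 : log (33/16) ≤ 3 / 4 := by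
    have : log (33/16) = log 2 + log (33/32) := by
      rw [← log_mul (by norm_num) (by norm_num)]; norm_num
    have h2 := log_le_sub_one_of_pos (x := 33/32) (by norm_num)
    rw [this]; linarith
  rw [abs_le]
  constructor
  · have : log (2/3) ≤ log z := log_le_log (by norm_num) hz.1
    have e : log (4/3) = log 2 + log (2/3) := by
      rw [← log_mul (by norm_num) (by norm_num)]; norm_num
    rw [e]; linarith
  · have : log z ≤ log (11/4) := log_le_log h0 hz.2
    have e : log (11/4) = log (33/16) + log (4/3) := by
      rw [← log_mul (by norm_num) (by norm_num)]; norm_num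
    linarith

lemma mid_mem : (4/3 : ℝ) ∈ Y := by constructor <;> norm_num

lemma lip_step {G G' : ℝ → ℝ} {L : ℝ} (hL : 0 ≤ L)
    (hG0 : ∀ u ∈ Y, 0 ≤ G u) (hG1 : ∀ u ∈ Y, G u ≤ 1)
    (hG : ∀ u ∈ Y, ∀ v ∈ Y, |G u - G v| ≤ L * |log u - log v|)
    (hG' : ∀ u ∈ Y, G' u = ∑' d, ww d u * G (Hd d u))
    {u v : ℝ} (hu : u ∈ Y) (hv : v ∈ Y) (huv : v ≤ u) :
    |G' u - G' v| ≤ 19 / 20 * L * |log u - log v| := by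
  have hu0 := Y_pos hu
  have hv0 := Y_pos hv
  set D := log u - log v with hD
  have hD0 : 0 ≤ D := sub_nonneg.2 (log_le_log hv0 huv)
  have su := ww_hasSum hu0
  have sv := ww_hasSum hv0
  have sum : ∀ w ∈ Y, Summable fun d => ww d w * G (Hd d w) := by
    intro w hw
    refine Summable.of_nonneg_of_le (fun d => ?_) (fun d => ?_) (ww_hasSum (Y_pos hw)).summable
    · exact mul_nonneg (ww_pos d (Y_pos hw)).le (hG0 _ (Hd_mem d hw))
    · exact mul_le_of_le_one_right (ww_pos d (Y_pos hw)).le (hG1 _ (Hd_mem d hw))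
  set c := G (4/3) with hc
  have e1 : G' u - G' v = ∑' d, (ww d u * G (Hd d u) - ww d v * G (Hd d v)
      - c * (ww d u - ww d v)) := by
    have hz : HasSum (fun d => c * (ww d u - ww d v)) 0 := by
      simpa using (su.sub sv).mul_left c
    rw [hG' u hu, hG' v hv]
    rw [((sum u hu).hasSum.sub (sum v hv).hasSum |>.sub hz).tsum_eq, sub_zero]
  have hb : HasSum (fun d => L / 5 * D * ww d u + (3 / 4 * L) * (D / 2) * (ww d u + ww d v))
      (L / 5 * D * 1 + (3 / 4 * L) * (D / 2) * (1 + 1)) :=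
    (su.mul_left _).add ((su.add sv).mul_left _)
  rw [abs_of_nonneg hD0, e1]
  have := tsum_of_norm_bounded hb (f := fun d => (ww d u * G (Hd d u) - ww d v * G (Hd d v)
      - c * (ww d u - ww d v))) ?_
  · rw [Real.norm_eq_abs] at this
    refine this.trans (le_of_eq ?_); ring
  · intro d
    rw [Real.norm_eq_abs]
    have hwu := ww_pos d hu0
    have hwv := ww_pos d hv0
    have t1 : |G (Hd d u) - G (Hd d v)| ≤ L / 5 * D := by
      refine (hG _ (Hd_mem d hu) _ (Hd_mem d hv)).trans ?_
      have := mul_le_mul_of_nonneg_left (Hd_contract d hv0 huv) hL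
      linarith
    have t2 : |G (Hd d v) - c| ≤ 3 / 4 * L := by
      refine (hG _ (Hd_mem d hv) _ mid_mem).trans ?_
      have := mul_le_mul_of_nonneg_left (log_mid (Hd_mem d hv)) hL
      linarith
    have t3 : |ww d u - ww d v| ≤ D / 2 * (ww d u + ww d v) := by
      have l := log_ratio_ge hv0 huv
      have hr : 1 ≤ u / v := (one_le_div hv0).2 huv
      obtain ⟨r1, r2⟩ := ww_ratio d hv0 huv
      set r := u / v
      have k1 : (r + 1) * (ww d u - ww d v) ≤ (r + 1) * (D / 2 * (ww d u + ww d v)) := by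
        have := mul_le_mul_of_nonneg_right l (add_pos hwu hwv).le
        nlinarith
      have k2 : (r + 1) * (ww d v - ww d u) ≤ (r + 1) * (D / 2 * (ww d u + ww d v)) := by
        have := mul_le_mul_of_nonneg_right l (add_pos hwu hwv).le
        nlinarith
      have hr1 : 0 < r + 1 := by linarith
      have k1' := le_of_mul_le_mul_left k1 hr1
      have k2' := le_of_mul_le_mul_left k2 hr1
      rw [abs_le]; constructor <;> linarith
    have e : ww d u * G (Hd d u) - ww d v * G (Hd d v) - c * (ww d u - ww d v) =
        ww d u * (G (Hd d u) - G (Hd d v)) + (ww d u - ww d v) * (G (Hd d v) - c) := by ring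
    rw [e]
    refine (abs_add_le _ _).trans ?_
    rw [abs_mul, abs_mul, abs_of_pos hwu]
    have i1 : ww d u * |G (Hd d u) - G (Hd d v)| ≤ ww d u * (L / 5 * D) := by gcongr
    have i2 : |ww d u - ww d v| * |G (Hd d v) - c| ≤
        (D / 2 * (ww d u + ww d v)) * (3 / 4 * L) := by gcongr
    linarith

lemma lip_all {B : Set ℝ} (hB : MeasurableSet B) (n : ℕ) {u v : ℝ} (hu : u ∈ Y) (hv : v ∈ Y) :
    |(Pm u).real (T^[n] ⁻¹' B) - (Pm v).real (T^[n] ⁻¹' B)| ≤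
      3 * (19 / 20) ^ n * |log u - log v| := by
  induction n generalizing u v with
  | zero =>
    simp only [Function.iterate_zero, preimage_id, pow_zero, mul_one]
    rcases le_total v u with h | h
    · refine (Pm_lip0 hu hv h hB).trans ?_
      gcongr; exact le_abs_self _
    · rw [abs_sub_comm, abs_sub_comm (log u)]
      refine (Pm_lip0 hv hu h hB).trans ?_
      gcongr; exact le_abs_self _
  | succ n ih =>
    have hm : MeasurableSet (T^[n] ⁻¹' B) := (measurable_T.iterate n) hB
    have main : ∀ u ∈ Y, ∀ v ∈ Y, v ≤ u →
      |(Pm u).real (T^[n+1] ⁻¹' B) - (Pm v).real (T^[n+1] ⁻¹' B)| ≤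
      3 * (19 / 20) ^ (n+1) * |log u - log v| := by
      intro u hu v hv huv
      have := lip_step (G := fun u => (Pm u).real (T^[n] ⁻¹' B))
        (G' := fun u => (Pm u).real (T^[n+1] ⁻¹' B)) (L := 3 * (19 / 20) ^ n) (by positivity)
        (fun u hu => measureReal_nonneg) (fun u hu => Pm_real_le (Y_pos hu) _)
        (fun u hu v hv => ih hu hv) (fun u hu => ?_) hu hv huv
      · refine this.trans (le_of_eq ?_); ring
      · rw [Function.iterate_succ, preimage_comp, Pm_pre_real (Y_pos hu) hm]
    rcases le_total v u with h | h
    · exact main u hu v hv h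
    · rw [abs_sub_comm, abs_sub_comm (log u)]; exact main v hv u hu h

lemma osc_all {B : Set ℝ} (hB : MeasurableSet B) (n : ℕ) {u v : ℝ} (hu : u ∈ Y) (hv : v ∈ Y) :
    (Pm u).real (T^[n] ⁻¹' B) ≤ (Pm v).real (T^[n] ⁻¹' B) + 5 * (19 / 20) ^ n := by
  have h1 := (le_abs_self _).trans (lip_all hB n hu hv)
  have h2 : |log u - log v| ≤ 3 / 2 := by
    have := abs_sub_le (log u) (log (4/3)) (log v)
    have a1 := log_mid hu
    have a2 := log_mid hv
    rw [abs_sub_comm] at a2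
    linarith
  have h3 : (0:ℝ) < (19 / 20) ^ n := by positivity
  nlinarith


/-! ### The invariant measure -/

noncomputable def cc : ℝ := 1 / log (2 + √3)

lemma sq3 : √3 * √3 = 3 := mul_self_sqrt (by norm_num)
lemma s3_lo : (5/3 : ℝ) < √3 := by
  rw [lt_sqrt (by norm_num)]; norm_num
lemma s3_hi : √3 < (7/4 : ℝ) := by
  rw [sqrt_lt (by norm_num) (by norm_num)]; norm_num

lemma log_pos3 : 0 < log (2 + √3) := log_pos (by linarith [s3_lo])
lemma cc_pos : 0 < cc := by unfold cc; have := log_pos3; positivity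

lemma den1_pos {x : ℝ} (h0 : 0 ≤ x) (h1 : x ≤ 1) : 0 < 1 - (2 - √3) * x := by
  have := s3_lo; nlinarith
lemma den2_pos {x : ℝ} (h0 : 0 ≤ x) : 0 < 1 + √3 * x := by positivity

lemma fdens_eq (x : ℝ) : fdens x = 2 * cc / ((1 - (2 - √3) * x) * (1 + √3 * x)) := by
  unfold fdens cc; rw [mul_one_div, div_div, mul_assoc]

lemma fdens_pos {x : ℝ} (h0 : 0 ≤ x) (h1 : x ≤ 1) : 0 < fdens x := by
  have := den1_pos h0 h1; have := den2_pos h0; have := cc_pos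
  rw [fdens_eq]; positivity

lemma measurable_fdens : Measurable fdens := by unfold fdens; fun_prop

lemma mu_apply {B : Set ℝ} (hB : MeasurableSet B) :
    mu B = ∫⁻ x in B ∩ Ioo 0 1, ENNReal.ofReal (fdens x) := wd_apply _ hB

/-- parameter interval of the mixture -/
def I0 : Set ℝ := Ioo (√3 - 1) (1 + √3)

lemma I0_sub : I0 ⊆ Y := by
  intro u hu
  have := s3_lo; have := s3_hi
  exact ⟨by linarith [hu.1], by linarith [hu.2]⟩

lemma mix {B : Set ℝ} (hB : MeasurableSet B) :
    mu B = ∫⁻ u in I0, ENNReal.ofReal (cc / u) * Pm u B := by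
  have h1 : ∀ u, ENNReal.ofReal (cc / u) * Pm u B =
      ∫⁻ x in B ∩ Ioo 0 1, ENNReal.ofReal (cc / u) * ENNReal.ofReal (kd u x) := by
    intro u; rw [Pm_apply _ hB, lintegral_const_mul' _ _ ENNReal.ofReal_ne_top]
  simp_rw [h1]
  rw [lintegral_lintegral_swap, mu_apply hB]
  · refine setLIntegral_congr_fun (hB.inter measurableSet_Ioo) fun x hx => ?_
    have hx0 := hx.2.1.le
    have hx1 := hx.2.2.le
    have lo := s3_lo
    have e1 : ∫⁻ u in I0, ENNReal.ofReal (cc / u) * ENNReal.ofReal (kd u x) =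
        ∫⁻ u in I0, ENNReal.ofReal (cc / (1 - x + u * x) ^ 2) := by
      refine setLIntegral_congr_fun measurableSet_Ioo fun u hu => ?_
      have hu0 := Y_pos (I0_sub hu)
      have hd := kd_den_pos hu0 hx0 hx1
      rw [← ENNReal.ofReal_mul (by have := cc_pos; positivity)]
      congr 1; unfold kd; field_simp
    rw [e1, I0, lint_ftc (F := fun u => cc * ((u - 1) / (1 - x + u * x)))]
    · congr 1
      rw [fdens_eq]
      have d1 := den1_pos hx0 hx1
      have d2 := den2_pos hx0
      have e2 : 1 - x + (1 + √3) * x = 1 + √3 * x := by ring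
      have e3 : 1 - x + (√3 - 1) * x = 1 - (2 - √3) * x := by ring
      rw [e2, e3]; field_simp; ring
    · linarith
    · intro u hu
      have hu0 : 0 < u := by linarith [hu.1]
      have hd := kd_den_pos hu0 hx0 hx1
      have f1 : HasDerivAt (fun u => u - 1) 1 u := (hasDerivAt_id u).sub_const 1
      have f2 : HasDerivAt (fun u => 1 - x + u * x) x u := by
        simpa using ((hasDerivAt_id u).mul_const x).const_add (1 - x)
      refine ((f1.fun_div f2 hd.ne').const_mul cc).congr_deriv ?_
      field_simp; ring
    · apply ContinuousOn.div (by fun_prop) (by fun_prop)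
      intro u hu
      have hu0 : 0 < u := by linarith [hu.1]
      exact pow_ne_zero 2 (kd_den_pos hu0 hx0 hx1).ne'
    · intro u hu; have := cc_pos; positivity
  · unfold kd; fun_prop

lemma mix_one : ∫⁻ u in I0, ENNReal.ofReal (cc / u) = 1 := by
  have lo := s3_lo
  have hne : √3 - 1 ≠ 0 := by linarith
  rw [I0, lint_ftc (F := fun u => cc * log u)]
  · rw [← mul_sub, ← log_div (by positivity) hne]
    have : (1 + √3) / (√3 - 1) = 2 + √3 := by
      rw [div_eq_iff hne]; linear_combination -sq3
    rw [this, cc, one_div_mul_cancel log_pos3.ne', ENNReal.ofReal_one]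
  · linarith
  · intro u hu
    have hu0 : 0 < u := by linarith [hu.1]
    refine ((hasDerivAt_log hu0.ne').const_mul cc).congr_deriv ?_
    rfl
  · apply ContinuousOn.div (by fun_prop) (by fun_prop)
    intro u hu; have hu0 : 0 < u := by linarith [hu.1]
    exact hu0.ne'
  · intro u hu; have hu0 : 0 < u := by linarith [hu.1]
    have := cc_pos; positivity

lemma mu_univ : mu univ = 1 := by
  rw [mix MeasurableSet.univ, ← mix_one]
  refine setLIntegral_congr_fun measurableSet_Ioo fun u hu => ?_
  rw [Pm_univ (Y_pos (I0_sub hu)), mul_one]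

instance : IsProbabilityMeasure mu := ⟨mu_univ⟩

/-- transfer of bounds from the family `Pm` to `mu` -/
lemma mix_le {A B : Set ℝ} (hA : MeasurableSet A) (hB : MeasurableSet B) {c : ENNReal}
    (hc : c ≠ ⊤) (h : ∀ u ∈ Y, Pm u A ≤ c * Pm u B) : mu A ≤ c * mu B := by
  rw [mix hA, mix hB, ← lintegral_const_mul' _ _ hc]
  refine setLIntegral_mono' measurableSet_Ioo fun u hu => ?_
  calc _ ≤ ENNReal.ofReal (cc / u) * (c * Pm u B) := by gcongr; exact h u (I0_sub hu)
    _ = _ := by ring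

lemma mix_ge {A B : Set ℝ} (hA : MeasurableSet A) (hB : MeasurableSet B) {c : ENNReal}
    (hc : c ≠ ⊤) (h : ∀ u ∈ Y, c * Pm u B ≤ Pm u A) : c * mu B ≤ mu A := by
  rw [mix hA, mix hB, ← lintegral_const_mul' _ _ hc]
  refine setLIntegral_mono' measurableSet_Ioo fun u hu => ?_
  calc _ = ENNReal.ofReal (cc / u) * (c * Pm u B) := by ring
    _ ≤ _ := by gcongr; exact h u (I0_sub hu)

/-! ### Invariance -/

lemma tele {b g : ℝ} (hb : 0 < b) (hg : 0 < g) :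
    HasSum (fun n : ℕ => 1 / (b + n * g) - 1 / (b + (n + 1) * g)) (1 / b) := by
  rw [hasSum_iff_tendsto_nat_of_nonneg]
  · have e : ∀ n : ℕ, ∑ i ∈ Finset.range n, (1 / (b + i * g) - 1 / (b + (i + 1) * g)) =
        1 / b - 1 / (b + n * g) := by
      intro n
      have := Finset.sum_range_sub' (fun i : ℕ => 1 / (b + i * g)) n
      simp only [Nat.cast_add, Nat.cast_one, Nat.cast_zero, zero_mul, add_zero] at this
      exact this
    simp_rw [e]
    have : Tendsto (fun n : ℕ => 1 / (b + n * g)) atTop (𝓝 0) := by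
      simp_rw [one_div]
      apply Tendsto.inv_tendsto_atTop
      apply tendsto_atTop_add_const_left
      exact tendsto_natCast_atTop_atTop.atTop_mul_const hg
    simpa using tendsto_const_nhds.sub this
  · intro n
    rw [sub_nonneg]
    apply one_div_le_one_div_of_le (by positivity); nlinarith

lemma fd_h (d : Br) {t : ℝ} (h0 : 0 < t) (h1 : t < 1) :
    1 / (cr d * t + cs d) ^ 2 * fdens (hB d t) =
      2 * cc / (((cr d * t + cs d) - (2 - √3) * (cp d * t + cq d)) *
        ((cr d * t + cs d) + √3 * (cp d * t + cq d))) := by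
  have hd := den_pos d h0.le h1.le
  have hr := hB_range d h0 h1
  have d1 := den1_pos hr.1.le hr.2.le
  have d2 := den2_pos hr.1.le
  have hh : hB d t * (cr d * t + cs d) = cp d * t + cq d := by
    unfold hB; exact div_mul_cancel₀ _ hd.ne'
  rw [fdens_eq, ← hh]
  field_simp

lemma tele_term {c g X Z : ℝ} (hg : g ≠ 0) (hX : X ≠ 0) (hZ : Z ≠ 0) (h : Z = X + g) :
    c / (X * Z) = c / g * (1 / X - 1 / Z) := by
  subst h; field_simp; ring

/-- the equivalence used to split sums over branches -/
def BrEquiv : (ℕ ⊕ ℕ) ⊕ (ℕ ⊕ ℕ) ≃ Br where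
  toFun := fun x => match x with
    | .inl (.inl n) => .ep n | .inl (.inr n) => .em n
    | .inr (.inl n) => .op n | .inr (.inr n) => .om n
  invFun := fun d => match d with
    | .ep n => .inl (.inl n) | .em n => .inl (.inr n)
    | .op n => .inr (.inl n) | .om n => .inr (.inr n)
  left_inv := by rintro ((n | n) | (n | n)) <;> rfl
  right_inv := by rintro (n | n | n | n) <;> rfl

lemma hasSum_Br {f : Br → ℝ} {w x y z : ℝ} (h1 : HasSum (fun n => f (.ep n)) w)
    (h2 : HasSum (fun n => f (.em n)) x) (h3 : HasSum (fun n => f (.op n)) y)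
    (h4 : HasSum (fun n => f (.om n)) z) : HasSum f ((w + x) + (y + z)) := by
  rw [← BrEquiv.hasSum_iff]
  refine HasSum.sum ?_ ?_
  · exact HasSum.sum h1 h2
  · exact HasSum.sum h3 h4


lemma fixed_density {t : ℝ} (h0 : 0 < t) (h1 : t < 1) :
    HasSum (fun d => 1 / (cr d * t + cs d) ^ 2 * fdens (hB d t)) (fdens t) := by
  have lo := s3_lo
  have hi := s3_hi
  have q := sq3
  simp_rw [fd_h _ h0 h1]
  have D1 := den1_pos h0.le h1.le
  rw [fdens_eq]
  generalize √3 = b at *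
  have hb0 : 0 < b := by linarith
  obtain ⟨g, hg⟩ : ∃ g, g = (1 + b) * (1 + t) := ⟨_, rfl⟩
  have hg0 : 0 < g := by rw [hg]; positivity
  have s1 := (tele (b := b + t) (g := 2) (by positivity) two_pos).mul_left cc
  have s2 := (tele (b := 2 + b - t) (g := 2) (by linarith) two_pos).mul_left cc
  have e3 : 2 * g + 1 - b * t = (2 + b) * (b + t) := by rw [hg]; linear_combination -q
  have e4 : 2 * g + t - b = (2 + b) * (1 + b * t) := by rw [hg]; linear_combination -t * q
  have p3 : 0 < 2 * g + 1 - b * t := by rw [e3]; positivity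
  have p4 : 0 < 2 * g + t - b := by rw [e4]; positivity
  have s3 := (tele p3 hg0).mul_left (2 * cc * (2 + b) / g)
  have s4 := (tele p4 hg0).mul_left (2 * cc * (2 + b) / g)
  have ha : (2 - b) * (2 + b) = 1 := by linear_combination -q
  have ha0 : 2 - b ≠ 0 := by intro h; rw [h, zero_mul] at ha; exact zero_ne_one ha
  have h2b : 2 + b ≠ 0 := by positivity
  have ha' : ∀ c X : ℝ, c / ((2 - b) * X) = c * (2 + b) / X := by
    intro c X
    rw [div_mul_eq_div_div, div_eq_mul_inv c, inv_eq_of_mul_eq_one_right ha]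
  have H := hasSum_Br (f := fun d => 2 * cc / (((cr d * t + cs d) - (2 - b) * (cp d * t + cq d)) *
        ((cr d * t + cs d) + b * (cp d * t + cq d))))
        (w := cc * (1 / (b + t))) (x := cc * (1 / (2 + b - t)))
        (y := (2 * cc * (2 + b) / g) * (1 / (2 * g + 1 - b * t)))
        (z := (2 * cc * (2 + b) / g) * (1 / (2 * g + t - b))) ?_ ?_ ?_ ?_
  · convert H using 1
    have e2 : 2 + b - t = (2 + b) * (1 - (2 - b) * t) := by linear_combination -t * q
    rw [e3, e4, e2, hg]
    have D2 : 0 < 1 + b * t := by positivity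
    have D3 : 0 < b + t := by positivity
    have i1 : (2 * cc * (2 + b) / ((1 + b) * (1 + t))) * (1 / ((2 + b) * (b + t))) +
        (2 * cc * (2 + b) / ((1 + b) * (1 + t))) * (1 / ((2 + b) * (1 + b * t))) =
        2 * cc / ((b + t) * (1 + b * t)) := by
      have : 0 < 1 + b := by positivity
      have : 0 < 1 + t := by positivity
      field_simp
      ring
    have i2 : cc * (1 / (b + t)) + 2 * cc / ((b + t) * (1 + b * t)) = cc * b / (1 + b * t) := by
      field_simp
      linear_combination -cc * q
    have i3 : cc * (1 / ((2 + b) * (1 - (2 - b) * t))) = cc * (2 - b) / (1 - (2 - b) * t) := by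
      rw [mul_one_div, div_eq_div_iff (by positivity) D1.ne']
      linear_combination -cc * (1 - (2 - b) * t) * ha
    rw [i1, i3]
    have i4 : cc * (1 / (b + t)) + cc * (2 - b) / (1 - (2 - b) * t) +
        2 * cc / ((b + t) * (1 + b * t)) = cc * b / (1 + b * t) + cc * (2 - b) / (1 - (2 - b) * t) := by
      rw [← i2]; ring
    rw [i4, div_add_div _ _ D2.ne' D1.ne']
    congr 1 <;> ring
  · refine (congrArg (HasSum · _) (funext fun n => ?_)).mpr s1
    have hA : (0:ℝ) < b + t + n * 2 := by positivity
    have hB : (0:ℝ) < b + t + (n + 1) * 2 := by positivity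
    have := tele_term (c := 2 * cc) (g := 2) two_ne_zero hA.ne' hB.ne' (by ring)
    rw [show 2 * cc / 2 = cc by ring] at this
    rw [← this]; simp only [cr, cs, cp, cq]; congr 1; ring
  · refine (congrArg (HasSum · _) (funext fun n => ?_)).mpr s2
    have hA : (0:ℝ) < 2 + b - t + n * 2 := by have : (0:ℝ) ≤ n := n.cast_nonneg; linarith
    have hB : (0:ℝ) < 2 + b - t + (n + 1) * 2 := by have : (0:ℝ) ≤ n := n.cast_nonneg; linarith
    have := tele_term (c := 2 * cc) (g := 2) two_ne_zero hA.ne' hB.ne' (by ring)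
    rw [show 2 * cc / 2 = cc by ring] at this
    rw [← this]; simp only [cr, cs, cp, cq]; congr 1; ring
  · refine (congrArg (HasSum · _) (funext fun n => ?_)).mpr s3
    have hA : (0:ℝ) < 2 * g + 1 - b * t + n * g := by positivity
    have hB : (0:ℝ) < 2 * g + 1 - b * t + (n + 1) * g := by positivity
    rw [← tele_term (c := 2 * cc * (2 + b)) hg0.ne' hA.ne' hB.ne' (by ring), ← ha']
    simp only [cr, cs, cp, cq, hg]
    congr 1
    have u1 : ((n + 2) * t + (n + 3)) + b * ((n + 1) * t + (n + 2)) =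
      2 * ((1 + b) * (1 + t)) + 1 - b * t + n * ((1 + b) * (1 + t)) := by ring
    have u2 : ((n + 2) * t + (n + 3)) - (2 - b) * ((n + 1) * t + (n + 2)) =
      (2 - b) * (2 * ((1 + b) * (1 + t)) + 1 - b * t + (n + 1) * ((1 + b) * (1 + t))) := by
      linear_combination -((n + 2) * t + (n + 3)) * ha
    rw [u1, u2]; ring
  · refine (congrArg (HasSum · _) (funext fun n => ?_)).mpr s4
    have hA : (0:ℝ) < 2 * g + t - b + n * g := by positivity
    have hB : (0:ℝ) < 2 * g + t - b + (n + 1) * g := by positivity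
    rw [← tele_term (c := 2 * cc * (2 + b)) hg0.ne' hA.ne' hB.ne' (by ring), ← ha']
    simp only [cr, cs, cp, cq, hg]
    congr 1
    have u1 : ((n + 3) * t + (n + 2)) + b * ((n + 2) * t + (n + 1)) =
      2 * ((1 + b) * (1 + t)) + t - b + n * ((1 + b) * (1 + t)) := by ring
    have u2 : ((n + 3) * t + (n + 2)) - (2 - b) * ((n + 2) * t + (n + 1)) =
      (2 - b) * (2 * ((1 + b) * (1 + t)) + t - b + (n + 1) * ((1 + b) * (1 + t))) := by
      linear_combination -((n + 3) * t + (n + 2)) * ha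
    rw [u1, u2]; ring

lemma mu_inv1 {B : Set ℝ} (hm : MeasurableSet B) : mu (T ⁻¹' B) = mu B := by
  classical
  have hk := key (fun x => ENNReal.ofReal (fdens x)) univ hm
  rw [preimage_univ, univ_inter] at hk
  simp only [mem_univ, if_true] at hk
  rw [mu_apply (measurable_T hm), hk, mu_apply hm, ← lintegral_tsum]
  · refine setLIntegral_congr_fun (hm.inter measurableSet_Ioo) fun t ht => ?_
    have hs := fixed_density ht.2.1 ht.2.2
    have hn : ∀ d, 0 ≤ 1 / (cr d * t + cs d) ^ 2 * fdens (hB d t) := by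
      intro d
      have hr := hB_range d ht.2.1 ht.2.2
      exact mul_nonneg (by positivity) (fdens_pos hr.1.le hr.2.le).le
    have e : ENNReal.ofReal (fdens t) =
        ∑' d, ENNReal.ofReal (1 / (cr d * t + cs d) ^ 2 * fdens (hB d t)) := by
      rw [← ENNReal.ofReal_tsum_of_nonneg hn hs.summable, hs.tsum_eq]
    rw [e]
    congr 1; ext d
    rw [ENNReal.ofReal_mul (by positivity)]
  · intro d
    have : Measurable (hB d) := by unfold hB; fun_prop
    have := measurable_fdens.comp this
    have h2 : Measurable fun t => fdens (hB d t) := this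
    fun_prop

lemma measurable_Tn (n : ℕ) : Measurable (T^[n]) := measurable_T.iterate n

lemma mu_inv {B : Set ℝ} (hm : MeasurableSet B) (n : ℕ) : mu (T^[n] ⁻¹' B) = mu B := by
  induction n with
  | zero => simp
  | succ n ih => rw [Function.iterate_succ, preimage_comp, mu_inv1 (measurable_Tn n hm), ih]


/-! ### Tail asymptotics -/

/-- distribution function of `mu` -/
noncomputable def FF (t : ℝ) : ℝ := cc * (log (1 + √3 * t) - log (1 - (2 - √3) * t))

lemma FF_deriv {t : ℝ} (h0 : 0 ≤ t) (h1 : t ≤ 1) : HasDerivAt FF (fdens t) t := by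
  have d1 := den1_pos h0 h1
  have d2 := den2_pos h0
  have f1 : HasDerivAt (fun t => 1 + √3 * t) (√3) t := by
    simpa using ((hasDerivAt_id t).const_mul (√3)).const_add 1
  have f2 : HasDerivAt (fun t => 1 - (2 - √3) * t) (-(2 - √3)) t := by
    simpa using ((hasDerivAt_id t).const_mul (2 - √3)).const_sub 1
  refine (((f1.log d2.ne').sub (f2.log d1.ne')).const_mul cc).congr_deriv ?_
  rw [fdens_eq, div_sub_div _ _ d2.ne' d1.ne', mul_div_assoc', div_eq_div_iff (by positivity) (by positivity)]
  ring

lemma FF_zero : FF 0 = 0 := by simp [FF]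

lemma fdens_zero : fdens 0 = 2 * cc := by rw [fdens_eq]; simp
lemma fdens_one : fdens 1 = cc := by
  rw [fdens_eq]
  have : (1 - (2 - √3) * 1) * (1 + √3 * 1) = 2 := by linear_combination sq3
  rw [this]; ring

/-- large partial quotient event -/
def E (c : ℝ) : Set ℝ := {x | c < (kk x : ℝ)}

lemma E_eq (c : ℝ) : E c = kk ⁻¹' {k : ℤ | c < (k : ℝ)} := rfl

lemma measurable_E (c : ℝ) : MeasurableSet (E c) := by
  rw [E_eq]; exact measurable_kk MeasurableSet.of_discrete

lemma E_inter {c : ℝ} {K : ℕ} (hK : 2 ≤ K) (hc : K = ⌊c⌋₊) :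
    E c ∩ Ioo 0 1 = Ioc 0 (1 / (2 * (K:ℝ) + 1)) ∪ Ico (1 - 1 / ((K:ℝ) + 1)) 1 := by
  have hK' : (2:ℝ) ≤ K := by exact_mod_cast hK
  have hc0 : 0 ≤ c := by
    by_contra h
    rw [Nat.floor_of_nonpos (by linarith)] at hc; omega
  have hcK := (Nat.floor_eq_iff hc0).1 hc.symm
  have A : ∀ k : ℤ, c < (k:ℝ) ↔ ((K:ℤ) + 1) ≤ k := by
    intro k
    constructor
    · intro h
      have : ((K:ℤ):ℝ) < k := by push_cast; linarith
      have := Int.cast_lt.1 this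
      omega
    · intro h
      have : (((K:ℤ) + 1 : ℤ) : ℝ) ≤ k := by exact_mod_cast h
      push_cast at this; linarith
  have q1 : 1 / (2 * (K:ℝ) + 1) ≤ 1 / 5 := one_div_le_one_div_of_le (by norm_num) (by linarith)
  have q2 : 1 / ((K:ℝ) + 1) ≤ 1 / 3 := one_div_le_one_div_of_le (by norm_num) (by linarith)
  have q3 : 0 < 1 / ((K:ℝ) + 1) := by positivity
  ext x
  simp only [E, mem_inter_iff, mem_ofPred_eq, A, mem_union, mem_Ioc, mem_Ico, mem_Ioo]
  unfold kk
  constructor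
  · rintro ⟨h, h0, h1⟩
    split_ifs at h with hx
    · left
      rw [Int.le_floor] at h; push_cast at h
      refine ⟨h0, ?_⟩
      rw [le_one_div h0 (by positivity)]; linarith
    · right
      rw [Int.le_floor] at h; push_cast at h
      refine ⟨?_, h1⟩
      have : 1 - x ≤ 1 / ((K:ℝ) + 1) := by
        rw [le_one_div (by linarith) (by positivity)]; linarith
      linarith
  · rintro (⟨h0, h1⟩ | ⟨h0, h1⟩)
    · refine ⟨?_, h0, by linarith⟩
      rw [if_pos (by linarith), Int.le_floor]; push_cast
      rw [le_one_div h0 (by positivity)] at h1; linarith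
    · refine ⟨?_, by linarith, h1⟩
      rw [if_neg (by linarith), Int.le_floor]; push_cast
      have : 1 - x ≤ 1 / ((K:ℝ) + 1) := by linarith
      rw [le_one_div (by linarith) (by positivity)] at this; linarith

lemma mu_E {c : ℝ} {K : ℕ} (hK : 2 ≤ K) (hc : K = ⌊c⌋₊) :
    mu.real (E c) = FF (1 / (2 * (K:ℝ) + 1)) + (FF 1 - FF (1 - 1 / ((K:ℝ) + 1))) := by
  have hK' : (2:ℝ) ≤ K := by exact_mod_cast hK
  have q1 : 1 / (2 * (K:ℝ) + 1) ≤ 1 / 5 := one_div_le_one_div_of_le (by norm_num) (by linarith)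
  have q0 : 0 < 1 / (2 * (K:ℝ) + 1) := by positivity
  have q2 : 1 / ((K:ℝ) + 1) ≤ 1 / 3 := one_div_le_one_div_of_le (by norm_num) (by linarith)
  have q3 : 0 < 1 / ((K:ℝ) + 1) := by positivity
  have hcont : ContinuousOn fdens (Icc 0 1) := by
    have : fdens = fun x => 2 * cc / ((1 - (2 - √3) * x) * (1 + √3 * x)) := funext fdens_eq
    rw [this]
    apply ContinuousOn.div (by fun_prop) (by fun_prop)
    intro x hx
    exact mul_ne_zero (den1_pos hx.1 hx.2).ne' (den2_pos hx.1).ne'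
  have main : ∀ {x y : ℝ}, 0 ≤ x → x ≤ y → y ≤ 1 →
      ∫⁻ t in Ioo x y, ENNReal.ofReal (fdens t) = ENNReal.ofReal (FF y - FF x) ∧ 0 ≤ FF y - FF x := by
    intro x y h0 hxy h1
    constructor
    · apply lint_ftc hxy
      · intro t ht; exact FF_deriv (by linarith [ht.1]) (by linarith [ht.2])
      · exact hcont.mono (Icc_subset_Icc h0 h1)
      · intro t ht; exact (fdens_pos (by linarith [ht.1]) (by linarith [ht.2])).le
    · rw [sub_nonneg]
      have : MonotoneOn FF (Icc 0 1) := by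
        apply monotoneOn_of_deriv_nonneg (convex_Icc 0 1)
        · intro t ht; exact (FF_deriv ht.1 ht.2).continuousAt.continuousWithinAt
        · intro t ht; rw [interior_Icc] at ht
          exact (FF_deriv ht.1.le ht.2.le).differentiableAt.differentiableWithinAt
        · intro t ht; rw [interior_Icc] at ht
          rw [(FF_deriv ht.1.le ht.2.le).deriv]; exact (fdens_pos ht.1.le ht.2.le).le
      exact this ⟨h0, by linarith⟩ ⟨by linarith, h1⟩ hxy
  obtain ⟨m1, n1⟩ := main le_rfl q0.le (by linarith)
  obtain ⟨m2, n2⟩ := main (x := 1 - 1 / ((K:ℝ) + 1)) (y := 1) (by linarith) (by linarith) le_rfl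
  rw [measureReal_def, mu_apply (measurable_E c), E_inter hK hc,
    lintegral_union measurableSet_Ico, setLIntegral_congr Ioo_ae_eq_Ioc.symm,
    setLIntegral_congr Ioo_ae_eq_Ico.symm, m1, m2, ← ENNReal.ofReal_add n1 n2,
    ENNReal.toReal_ofReal (add_nonneg n1 n2), FF_zero, sub_zero]
  rw [Set.disjoint_left]
  intro x hx hx'
  linarith [hx.2, hx'.1]

lemma tail_lim {y : ℝ} (hy : 0 < y) :
    Tendsto (fun N : ℕ => (N:ℝ) * mu.real (E ((2 / log (2 + √3)) * N * y))) atTop (𝓝 (1 / y)) := by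
  have hc := cc_pos
  have e0 : 2 / log (2 + √3) = 2 * cc := by unfold cc; ring
  rw [e0]
  obtain ⟨α, hα⟩ : ∃ α, α = 2 * cc * y := ⟨_, rfl⟩
  have hα0 : 0 < α := by rw [hα]; positivity
  have e1 : ∀ N : ℕ, 2 * cc * N * y = α * N := by intro N; rw [hα]; ring
  simp_rw [e1]
  have t1 : Tendsto (fun N : ℕ => (⌊α * (N:ℝ)⌋₊ : ℝ) / (N:ℝ)) atTop (𝓝 α) :=
    (tendsto_nat_floor_mul_div_atTop hα0.le).comp tendsto_natCast_atTop_atTop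
  have tN : Tendsto (fun N : ℕ => 1 / (N:ℝ)) atTop (𝓝 0) := tendsto_one_div_atTop_nhds_zero_nat
  have tK : Tendsto (fun N : ℕ => ⌊α * (N:ℝ)⌋₊) atTop atTop :=
    tendsto_nat_floor_atTop.comp (tendsto_natCast_atTop_atTop.const_mul_atTop hα0)
  have tKr : Tendsto (fun N : ℕ => (⌊α * (N:ℝ)⌋₊ : ℝ)) atTop atTop :=
    tendsto_natCast_atTop_atTop.comp tK
  have a1 : Tendsto (fun N : ℕ => (N:ℝ) * (1 / (2 * (⌊α * (N:ℝ)⌋₊:ℝ) + 1))) atTop (𝓝 (1 / (2 * α))) := by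
    have : Tendsto (fun N : ℕ => 1 / (2 * ((⌊α * (N:ℝ)⌋₊:ℝ) / N) + 1 / (N:ℝ))) atTop
        (𝓝 (1 / (2 * α + 0))) :=
      tendsto_const_nhds.div ((t1.const_mul 2).add tN) (by positivity)
    rw [add_zero] at this
    refine this.congr' ?_
    filter_upwards [eventually_gt_atTop 0] with N hN
    have : (0:ℝ) < N := by exact_mod_cast hN
    field_simp
  have a2 : Tendsto (fun N : ℕ => (N:ℝ) * (1 / ((⌊α * (N:ℝ)⌋₊:ℝ) + 1))) atTop (𝓝 (1 / α)) := by
    have : Tendsto (fun N : ℕ => 1 / (((⌊α * (N:ℝ)⌋₊:ℝ) / N) + 1 / (N:ℝ))) atTop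
        (𝓝 (1 / (α + 0))) :=
      tendsto_const_nhds.div (t1.add tN) (by positivity)
    rw [add_zero] at this
    refine this.congr' ?_
    filter_upwards [eventually_gt_atTop 0] with N hN
    have : (0:ℝ) < N := by exact_mod_cast hN
    field_simp
  have d1 : Tendsto (fun N : ℕ => 1 / (2 * (⌊α * (N:ℝ)⌋₊:ℝ) + 1)) atTop (𝓝[≠] 0) := by
    rw [tendsto_nhdsWithin_iff]
    constructor
    · simp_rw [one_div]
      exact (tendsto_atTop_add_const_right _ _ (tKr.const_mul_atTop two_pos)).inv_tendsto_atTop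
    · refine Eventually.of_forall fun N => ?_
      have : (0:ℝ) < 1 / (2 * (⌊α * (N:ℝ)⌋₊:ℝ) + 1) := by positivity
      exact this.ne'
  have d2 : Tendsto (fun N : ℕ => -(1 / ((⌊α * (N:ℝ)⌋₊:ℝ) + 1))) atTop (𝓝[≠] 0) := by
    rw [tendsto_nhdsWithin_iff]
    constructor
    · rw [← neg_zero]
      apply Tendsto.neg
      simp_rw [one_div]
      exact (tendsto_atTop_add_const_right _ _ tKr).inv_tendsto_atTop
    · refine Eventually.of_forall fun N => ?_
      have : (0:ℝ) < 1 / ((⌊α * (N:ℝ)⌋₊:ℝ) + 1) := by positivity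
      exact neg_ne_zero.2 this.ne'
  have f1 := (hasDerivAt_iff_tendsto_slope_zero.1 (FF_deriv le_rfl zero_le_one)).comp d1
  have f2 := (hasDerivAt_iff_tendsto_slope_zero.1 (FF_deriv zero_le_one le_rfl)).comp d2
  have lim := (a1.mul f1).add (a2.mul f2)
  have e2 : 1 / (2 * α) * fdens 0 + 1 / α * fdens 1 = 1 / y := by
    rw [fdens_zero, fdens_one, hα]; field_simp; norm_num
  rw [e2] at lim
  refine lim.congr' ?_
  filter_upwards [tK.eventually_ge_atTop 2] with N hN
  rw [mu_E hN rfl]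
  simp only [Function.comp_apply, smul_eq_mul, zero_add, FF_zero, sub_zero]
  have p1 : (0:ℝ) < 2 * (⌊α * (N:ℝ)⌋₊:ℝ) + 1 := by positivity
  have p2 : (0:ℝ) < (⌊α * (N:ℝ)⌋₊:ℝ) + 1 := by positivity
  rw [← sub_eq_add_neg]
  generalize FF (1 / _) = A
  generalize FF (1 - 1 / _) = B
  field_simp
  ring


/-! ### Decoupling -/

lemma S_zero (c : ℝ) : S c 0 = univ := by ext x; simp [S]

lemma S_succ (c : ℝ) (n : ℕ) : S c (n + 1) = kk ⁻¹' {k : ℤ | (k : ℝ) ≤ c} ∩ T ⁻¹' S c n := by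
  ext x
  constructor
  · intro h
    refine ⟨?_, fun i hi => ?_⟩
    · simpa using h 0 (by omega)
    · have := h (i + 1) (by omega)
      rwa [Function.iterate_succ_apply] at this
  · rintro ⟨h1, h2⟩ i hi
    cases i with
    | zero => simpa using h1
    | succ i => rw [Function.iterate_succ_apply]; exact h2 i (by omega)

lemma measurable_S (c : ℝ) (n : ℕ) : MeasurableSet (S c n) := by
  induction n with
  | zero => rw [S_zero]; exact MeasurableSet.univ
  | succ n ih => rw [S_succ]; exact (measurable_kk MeasurableSet.of_discrete).inter (measurable_T ih)

lemma S_add (c : ℝ) (m n : ℕ) : S c (m + n) = S c m ∩ T^[m] ⁻¹' S c n := by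
  ext x
  constructor
  · intro h
    refine ⟨fun i hi => h i (by omega), fun i hi => ?_⟩
    rw [← Function.iterate_add_apply]; exact h _ (by omega)
  · rintro ⟨h1, h2⟩ i hi
    by_cases him : i < m
    · exact h1 i him
    · have := h2 (i - m) (by omega)
      rwa [← Function.iterate_add_apply, Nat.sub_add_cancel (by omega)] at this

lemma step_le (J : Set ℤ) {A D : Set ℝ} (hA : MeasurableSet A) (hD : MeasurableSet D)
    {c : ENNReal} (h : ∀ v ∈ Y, Pm v A ≤ c * Pm v D) {u : ℝ} (hu : u ∈ Y) :
    Pm u (kk ⁻¹' J ∩ T ⁻¹' A) ≤ c * Pm u (kk ⁻¹' J ∩ T ⁻¹' D) := by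
  classical
  rw [Pm_step (Y_pos hu) J hA, Pm_step (Y_pos hu) J hD, ← ENNReal.tsum_mul_left]
  refine ENNReal.tsum_le_tsum fun d => ?_
  split_ifs
  · calc _ ≤ ENNReal.ofReal (ww d u) * (c * Pm (Hd d u) D) := by gcongr; exact h _ (Hd_mem d hu)
      _ = _ := by ring
  · simp

lemma step_ge (J : Set ℤ) {A D : Set ℝ} (hA : MeasurableSet A) (hD : MeasurableSet D)
    {c : ENNReal} (h : ∀ v ∈ Y, c * Pm v D ≤ Pm v A) {u : ℝ} (hu : u ∈ Y) :
    c * Pm u (kk ⁻¹' J ∩ T ⁻¹' D) ≤ Pm u (kk ⁻¹' J ∩ T ⁻¹' A) := by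
  classical
  rw [Pm_step (Y_pos hu) J hA, Pm_step (Y_pos hu) J hD, ← ENNReal.tsum_mul_left]
  refine ENNReal.tsum_le_tsum fun d => ?_
  split_ifs
  · calc _ = ENNReal.ofReal (ww d u) * (c * Pm (Hd d u) D) := by ring
      _ ≤ _ := by gcongr; exact h _ (Hd_mem d hu)
  · simp

lemma S_inter_succ (c : ℝ) (M : ℕ) (A : Set ℝ) : S c (M + 1) ∩ T^[M + 1] ⁻¹' A =
    kk ⁻¹' {k : ℤ | (k : ℝ) ≤ c} ∩ T ⁻¹' (S c M ∩ T^[M] ⁻¹' A) := by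
  rw [S_succ, Function.iterate_succ, preimage_comp, preimage_inter, inter_assoc]

lemma S_le (c : ℝ) (M : ℕ) {A : Set ℝ} (hA : MeasurableSet A)
    {h : ENNReal} (hh : ∀ v ∈ Y, Pm v A ≤ h) {u : ℝ} (hu : u ∈ Y) :
    Pm u (S c M ∩ T^[M] ⁻¹' A) ≤ h * Pm u (S c M) := by
  induction M generalizing u with
  | zero => rw [S_zero, Pm_univ (Y_pos hu)]; simpa using hh u hu
  | succ M ih =>
    rw [S_inter_succ, S_succ]
    exact step_le _ ((measurable_S c M).inter (measurable_Tn M hA)) (measurable_S c M)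
      (fun v hv => ih hv) hu

lemma S_ge (c : ℝ) (M : ℕ) {A : Set ℝ} (hA : MeasurableSet A)
    {h : ENNReal} (hh : ∀ v ∈ Y, h ≤ Pm v A) {u : ℝ} (hu : u ∈ Y) :
    h * Pm u (S c M) ≤ Pm u (S c M ∩ T^[M] ⁻¹' A) := by
  induction M generalizing u with
  | zero => rw [S_zero, Pm_univ (Y_pos hu)]; simpa using hh u hu
  | succ M ih =>
    rw [S_inter_succ, S_succ]
    exact step_ge _ ((measurable_S c M).inter (measurable_Tn M hA)) (measurable_S c M)
      (fun v hv => ih hv) hu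

lemma E_le (c : ℝ) {A : Set ℝ} (hA : MeasurableSet A)
    {h : ENNReal} (hh : ∀ v ∈ Y, Pm v A ≤ h) {u : ℝ} (hu : u ∈ Y) :
    Pm u (E c ∩ T ⁻¹' A) ≤ h * Pm u (E c) := by
  have := step_le {k : ℤ | c < (k:ℝ)} hA MeasurableSet.univ (c := h)
    (fun v hv => by rw [Pm_univ (Y_pos hv), mul_one]; exact hh v hv) hu
  rwa [preimage_univ, inter_univ, ← E_eq] at this

lemma E_ge (c : ℝ) {A : Set ℝ} (hA : MeasurableSet A)
    {h : ENNReal} (hh : ∀ v ∈ Y, h ≤ Pm v A) {u : ℝ} (hu : u ∈ Y) :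
    h * Pm u (E c) ≤ Pm u (E c ∩ T ⁻¹' A) := by
  have := step_ge {k : ℤ | c < (k:ℝ)} hA MeasurableSet.univ (c := h)
    (fun v hv => by rw [Pm_univ (Y_pos hv), mul_one]; exact hh v hv) hu
  rwa [preimage_univ, inter_univ, ← E_eq] at this

lemma real_le {A D : Set ℝ} (hA : MeasurableSet A) (hD : MeasurableSet D) {c : ℝ} (hc : 0 ≤ c)
    (h : ∀ u ∈ Y, Pm u A ≤ ENNReal.ofReal c * Pm u D) : mu.real A ≤ c * mu.real D := by
  have := mix_le hA hD ENNReal.ofReal_ne_top h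
  have := ENNReal.toReal_mono (ENNReal.mul_ne_top ENNReal.ofReal_ne_top (measure_ne_top _ _)) this
  rwa [ENNReal.toReal_mul, ENNReal.toReal_ofReal hc] at this

lemma real_ge {A D : Set ℝ} (hA : MeasurableSet A) (hD : MeasurableSet D) {c : ℝ}
    (h : ∀ u ∈ Y, ENNReal.ofReal c * Pm u D ≤ Pm u A) : c * mu.real D ≤ mu.real A := by
  by_cases hc : 0 ≤ c
  · have := mix_ge hA hD ENNReal.ofReal_ne_top h
    have := ENNReal.toReal_mono (measure_ne_top _ _) this
    rwa [ENNReal.toReal_mul, ENNReal.toReal_ofReal hc] at this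
  · have h1 : 0 ≤ mu.real D := measureReal_nonneg
    have h2 : 0 ≤ mu.real A := measureReal_nonneg
    nlinarith

lemma Pm_near {B : Set ℝ} (hB : MeasurableSet B) (g : ℕ) {v : ℝ} (hv : v ∈ Y) :
    ENNReal.ofReal (mu.real B - 5 * (19/20)^g) ≤ Pm v (T^[g] ⁻¹' B) ∧
    Pm v (T^[g] ⁻¹' B) ≤ ENNReal.ofReal (mu.real B + 5 * (19/20)^g) := by
  have hC := measurable_Tn g hB
  have hinv : mu.real (T^[g] ⁻¹' B) = mu.real B := by
    rw [measureReal_def, mu_inv hB, measureReal_def]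
  have hone : mu.real univ = 1 := by simp
  have hpos : (0:ℝ) ≤ 5 * (19/20)^g := by positivity
  have hnn : 0 ≤ (Pm v).real (T^[g] ⁻¹' B) := measureReal_nonneg
  have e : Pm v (T^[g] ⁻¹' B) = ENNReal.ofReal ((Pm v).real (T^[g] ⁻¹' B)) := by
    rw [ofReal_measureReal]
  have eu : ∀ u, Pm u (T^[g] ⁻¹' B) = ENNReal.ofReal ((Pm u).real (T^[g] ⁻¹' B)) := by
    intro u; rw [ofReal_measureReal]
  constructor
  · have := real_le hC MeasurableSet.univ (c := (Pm v).real (T^[g] ⁻¹' B) + 5 * (19/20)^g)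
      (by positivity) (fun u hu => by
        rw [Pm_univ (Y_pos hu), mul_one, eu u]
        exact ENNReal.ofReal_le_ofReal (osc_all hB g hu hv))
    rw [hinv, hone, mul_one] at this
    rw [e]; apply ENNReal.ofReal_le_ofReal; linarith
  · have := real_ge hC MeasurableSet.univ (c := (Pm v).real (T^[g] ⁻¹' B) - 5 * (19/20)^g)
      (fun u hu => by
        rw [Pm_univ (Y_pos hu), mul_one, eu u]
        apply ENNReal.ofReal_le_ofReal; linarith [osc_all hB g hv hu])
    rw [hinv, hone, mul_one] at this
    rw [e]; apply ENNReal.ofReal_le_ofReal; linarith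

lemma Pm_le5mu {B : Set ℝ} (hB : MeasurableSet B) {v : ℝ} (hv : v ∈ Y) :
    Pm v B ≤ ENNReal.ofReal (5 * mu.real B) := by
  have e : Pm v B = ENNReal.ofReal ((Pm v).real B) := by rw [ofReal_measureReal]
  have := real_ge hB MeasurableSet.univ (c := (Pm v).real B / 5) (fun u hu => by
    rw [Pm_univ (Y_pos hu), mul_one, ENNReal.ofReal_div_of_pos (by norm_num), ← e]
    apply ENNReal.div_le_of_le_mul
    have := Pm_le5 hv hu hB
    rw [mul_comm]; simpa using this)
  have hone : mu.real univ = 1 := by simp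
  rw [hone, mul_one] at this
  rw [e]; apply ENNReal.ofReal_le_ofReal; linarith

lemma decS (c : ℝ) (M g : ℕ) {B : Set ℝ} (hB : MeasurableSet B) :
    (mu.real B - 5 * (19/20)^g) * mu.real (S c M) ≤ mu.real (S c M ∩ T^[M] ⁻¹' (T^[g] ⁻¹' B)) ∧
    mu.real (S c M ∩ T^[M] ⁻¹' (T^[g] ⁻¹' B)) ≤ (mu.real B + 5 * (19/20)^g) * mu.real (S c M) := by
  have hC := measurable_Tn g hB
  have hA := (measurable_S c M).inter (measurable_Tn M hC)
  have : 0 ≤ mu.real B := measureReal_nonneg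
  exact ⟨real_ge hA (measurable_S c M) fun u hu => S_ge c M hC (fun v hv => (Pm_near hB g hv).1) hu,
    real_le hA (measurable_S c M) (by positivity) fun u hu =>
      S_le c M hC (fun v hv => (Pm_near hB g hv).2) hu⟩

lemma decE (c : ℝ) (g : ℕ) {B : Set ℝ} (hB : MeasurableSet B) :
    (mu.real B - 5 * (19/20)^g) * mu.real (E c) ≤ mu.real (E c ∩ T ⁻¹' (T^[g] ⁻¹' B)) ∧
    mu.real (E c ∩ T ⁻¹' (T^[g] ⁻¹' B)) ≤ (mu.real B + 5 * (19/20)^g) * mu.real (E c) := by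
  have hC := measurable_Tn g hB
  have hA := (measurable_E c).inter (measurable_T hC)
  have : 0 ≤ mu.real B := measureReal_nonneg
  exact ⟨real_ge hA (measurable_E c) fun u hu => E_ge c hC (fun v hv => (Pm_near hB g hv).1) hu,
    real_le hA (measurable_E c) (by positivity) fun u hu =>
      E_le c hC (fun v hv => (Pm_near hB g hv).2) hu⟩

lemma decE5 (c : ℝ) {B : Set ℝ} (hB : MeasurableSet B) :
    mu.real (E c ∩ T ⁻¹' B) ≤ (5 * mu.real B) * mu.real (E c) := by
  have : 0 ≤ mu.real B := measureReal_nonneg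
  exact real_le ((measurable_E c).inter (measurable_T hB)) (measurable_E c) (by positivity)
    fun u hu => E_le c hB (fun v hv => Pm_le5mu hB hv) hu

/-! ### Recursion for the no-exceedance probabilities -/

lemma f_step (c : ℝ) (n : ℕ) :
    mu.real (S c n) = mu.real (S c (n + 1)) + mu.real (E c ∩ T ⁻¹' S c n) := by
  have h1 : mu.real (T ⁻¹' S c n) = mu.real (S c n) := by
    rw [measureReal_def, mu_inv1 (measurable_S c n), measureReal_def]
  rw [← h1, ← measureReal_union]
  · congr 1
    rw [S_succ, E_eq, ← union_inter_distrib_right, ← preimage_union]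
    have : {k : ℤ | (k:ℝ) ≤ c} ∪ {k : ℤ | c < (k:ℝ)} = univ := by
      ext k; simpa using le_or_gt _ _
    rw [this, preimage_univ, univ_inter]
  · rw [S_succ, E_eq, Set.disjoint_left]
    rintro x ⟨hx, -⟩ ⟨hx', -⟩
    exact absurd (show (kk x : ℝ) ≤ c from hx) (not_le.2 (show c < (kk x : ℝ) from hx'))
  · exact (measurable_E c).inter (measurable_T (measurable_S c n))

lemma f_dec (c : ℝ) (n : ℕ) : mu.real (S c n) ≤ mu.real (S c (n + 1)) + mu.real (E c) := by
  have h : mu.real (E c ∩ T ⁻¹' S c n) ≤ mu.real (E c) := measureReal_mono inter_subset_left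
  rw [f_step c n]; linarith

lemma f_add (c : ℝ) (m g : ℕ) : mu.real (S c m) ≤ mu.real (S c (g + m)) + g * mu.real (E c) := by
  induction g with
  | zero => simp
  | succ g ih =>
    have := f_dec c (g + m)
    rw [show g + 1 + m = g + m + 1 by ring]; push_cast; linarith

lemma f_zero (c : ℝ) : mu.real (S c 0) = 1 := by rw [S_zero]; simp

lemma compl_le (c : ℝ) (g : ℕ) : mu.real (S c g)ᶜ ≤ g * mu.real (E c) := by
  rw [probReal_compl_eq_one_sub (measurable_S c g)]
  have := f_add c 0 g
  rw [f_zero, add_zero] at this; linarith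

lemma f_rec (c : ℝ) (g m : ℕ) :
    |mu.real (S c (g + m + 1)) - (1 - mu.real (E c)) * mu.real (S c (g + m))| ≤
      mu.real (E c) * (5 * (19/20)^g + 5 * g * mu.real (E c)) := by
  have h1 := f_step c (g + m)
  have h2 := decE c g (measurable_S c m)
  have h3 := decE5 c (measurable_S c g).compl
  have h4 := compl_le c g
  have h5 := f_add c m g
  have hp : 0 ≤ mu.real (E c) := measureReal_nonneg
  have hc0 : 0 ≤ mu.real (S c g)ᶜ := measureReal_nonneg
  have u1 : mu.real (E c ∩ T ⁻¹' S c (g + m)) ≤ mu.real (E c ∩ T ⁻¹' (T^[g] ⁻¹' S c m)) := by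
    refine measureReal_mono ?_
    rw [S_add]
    exact inter_subset_inter_right _ (preimage_mono inter_subset_right)
  have u2 : mu.real (E c ∩ T ⁻¹' (T^[g] ⁻¹' S c m)) ≤
      mu.real (E c ∩ T ⁻¹' S c (g + m)) + mu.real (E c ∩ T ⁻¹' (S c g)ᶜ) := by
    refine (measureReal_mono ?_).trans (measureReal_union_le _ _)
    rintro x ⟨hx1, hx2⟩
    rw [S_add]
    by_cases hx : T x ∈ S c g
    · exact Or.inl ⟨hx1, hx, hx2⟩
    · exact Or.inr ⟨hx1, hx⟩
  have h6 : mu.real (S c (g + m)) ≤ mu.real (S c m) := by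
    have : mu.real (T^[g] ⁻¹' S c m) = mu.real (S c m) := by
      rw [measureReal_def, mu_inv (measurable_S c m), measureReal_def]
    rw [← this, S_add]; exact measureReal_mono inter_subset_right
  have hg : (0:ℝ) ≤ g := g.cast_nonneg
  rw [abs_le]
  generalize mu.real (E c) = p at *
  generalize mu.real (S c g)ᶜ = w at *
  generalize mu.real (S c m) = a at *
  generalize mu.real (S c (g + m)) = b at *
  have k1 : a * p ≤ (b + g * p) * p := by gcongr
  have k2 : b * p ≤ a * p := by gcongr
  have k3 : 5 * w * p ≤ 5 * (g * p) * p := by gcongr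
  have k4 : 0 ≤ g * p * p := by positivity
  constructor <;> nlinarith [h2.1, h2.2]

lemma f_pow (c : ℝ) (g n : ℕ) :
    |mu.real (S c n) - (1 - mu.real (E c)) ^ n| ≤
      g * mu.real (E c) + n * (mu.real (E c) * (5 * (19/20)^g + 5 * g * mu.real (E c))) := by
  have hp : 0 ≤ mu.real (E c) := measureReal_nonneg
  have hp1 : mu.real (E c) ≤ 1 := measureReal_le_one
  have hδ : 0 ≤ mu.real (E c) * (5 * (19/20)^g + 5 * g * mu.real (E c)) := by positivity
  have small : ∀ n ≤ g, |mu.real (S c n) - (1 - mu.real (E c)) ^ n| ≤ g * mu.real (E c) := by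
    intro n hn
    have a1 := f_add c 0 n
    rw [f_zero, add_zero] at a1
    have a2 : mu.real (S c n) ≤ 1 := measureReal_le_one
    have a3 : (1 - mu.real (E c)) ^ n ≤ 1 := pow_le_one₀ (by linarith) (by linarith)
    have a4 := one_add_mul_le_pow (a := -mu.real (E c)) (by linarith) n
    rw [← sub_eq_add_neg] at a4
    have a5 : (n:ℝ) * mu.real (E c) ≤ g * mu.real (E c) := by gcongr
    rw [abs_le]; constructor <;> linarith
  by_cases hn : n ≤ g
  · have := small n hn
    have h2 : 0 ≤ n * (mu.real (E c) * (5 * (19/20)^g + 5 * g * mu.real (E c))) := by positivity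
    linarith
  · obtain ⟨m, rfl⟩ : ∃ m, n = g + m := ⟨n - g, by omega⟩
    clear hn
    have key : ∀ m : ℕ, |mu.real (S c (g + m)) - (1 - mu.real (E c)) ^ (g + m)| ≤
      g * mu.real (E c) + m * (mu.real (E c) * (5 * (19/20)^g + 5 * g * mu.real (E c))) := by
      intro m
      induction m with
      | zero => simpa using small g le_rfl
      | succ m ih =>
        have hr := f_rec c g m
        have e : mu.real (S c (g + (m + 1))) - (1 - mu.real (E c)) ^ (g + (m + 1)) =
          (mu.real (S c (g + m + 1)) - (1 - mu.real (E c)) * mu.real (S c (g + m))) +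
          (1 - mu.real (E c)) * (mu.real (S c (g + m)) - (1 - mu.real (E c)) ^ (g + m)) := by
          rw [← add_assoc]; ring
        rw [e]
        refine (abs_add_le _ _).trans ?_
        rw [abs_mul, abs_of_nonneg (by linarith : 0 ≤ 1 - mu.real (E c))]
        have : (1 - mu.real (E c)) * |mu.real (S c (g + m)) - (1 - mu.real (E c)) ^ (g + m)| ≤
          1 * |mu.real (S c (g + m)) - (1 - mu.real (E c)) ^ (g + m)| := by
          gcongr; linarith
        push_cast; linarith
    refine (key m).trans ?_
    gcongr
    omega

lemma Q_bound {c c' : ℝ} (M g m : ℕ) (hcc : c' ≤ c) :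
    |mu.real (S c (M + (g + m)) ∩ S c' M) - mu.real (S c' M) * (1 - mu.real (E c)) ^ m| ≤
      5 * (19/20)^g + 2 * (g * mu.real (E c)) +
        m * (mu.real (E c) * (5 * (19/20)^g + 5 * g * mu.real (E c))) := by
  have hset : S c (M + (g + m)) ∩ S c' M = S c' M ∩ T^[M] ⁻¹' S c (g + m) := by
    rw [S_add]
    ext x
    constructor
    · rintro ⟨⟨-, h2⟩, h3⟩; exact ⟨h3, h2⟩
    · rintro ⟨h1, h2⟩; exact ⟨⟨fun i hi => (h1 i hi).trans hcc, h2⟩, h1⟩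
  rw [hset]
  have h2 := decS c' M g (measurable_S c m)
  have h4 := compl_le c g
  have h5 := f_pow c g m
  have u1 : mu.real (S c' M ∩ T^[M] ⁻¹' S c (g + m)) ≤
      mu.real (S c' M ∩ T^[M] ⁻¹' (T^[g] ⁻¹' S c m)) := by
    refine measureReal_mono ?_
    rw [S_add]
    exact inter_subset_inter_right _ (preimage_mono inter_subset_right)
  have u2 : mu.real (S c' M ∩ T^[M] ⁻¹' (T^[g] ⁻¹' S c m)) ≤
      mu.real (S c' M ∩ T^[M] ⁻¹' S c (g + m)) + mu.real (T^[M] ⁻¹' (S c g)ᶜ) := by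
    refine (measureReal_mono ?_).trans (measureReal_union_le _ _)
    rintro x ⟨hx1, hx2⟩
    rw [S_add]
    by_cases hx : T^[M] x ∈ S c g
    · exact Or.inl ⟨hx1, hx, hx2⟩
    · exact Or.inr hx
  have h6 : mu.real (T^[M] ⁻¹' (S c g)ᶜ) = mu.real (S c g)ᶜ := by
    rw [measureReal_def, mu_inv (measurable_S c g).compl, measureReal_def]
  rw [h6] at u2
  have hr0 : 0 ≤ mu.real (S c' M) := measureReal_nonneg
  have hr1 : mu.real (S c' M) ≤ 1 := measureReal_le_one
  have hp : 0 ≤ mu.real (E c) := measureReal_nonneg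
  have hθ : (0:ℝ) ≤ 5 * (19/20)^g := by positivity
  have hgp : 0 ≤ g * mu.real (E c) := by positivity
  generalize mu.real (S c' M) = r at *
  generalize mu.real (E c) = p at *
  generalize mu.real (S c m) = f at *
  generalize (5 * (19/20)^g : ℝ) = θ at *
  generalize (m * (p * (θ + 5 * g * p)) : ℝ) = X at *
  rw [abs_le] at h5 ⊢
  have k1 : θ * r ≤ θ := mul_le_of_le_one_right hθ hr1
  have k0 : 0 ≤ θ * r := by positivity
  have k2 : |r * (f - (1 - p)^m)| ≤ g * p + X := by
    rw [abs_mul, abs_of_nonneg hr0]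
    calc r * |f - (1-p)^m| ≤ 1 * |f - (1-p)^m| := by gcongr
      _ ≤ _ := by rw [one_mul]; exact abs_le.2 h5
  rw [abs_le] at k2
  constructor <;> linarith [h2.1, h2.2, k2.1, k2.2]


lemma ae_good : ∀ᵐ x ∂mu, x ∈ Ioo (0:ℝ) 1 ∩ {x | Irrational x} := by
  have h1 : ∀ᵐ x ∂(volume.restrict (Ioo (0:ℝ) 1)), x ∈ Ioo (0:ℝ) 1 ∩ {x | Irrational x} := by
    have h2 : ∀ᵐ x ∂(volume.restrict (Ioo (0:ℝ) 1)), Irrational x := by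
      apply ae_restrict_of_ae
      rw [ae_iff]; exact volume_not_irr
    filter_upwards [h2, ae_restrict_mem measurableSet_Ioo] with x hx hx'
    exact ⟨hx', hx⟩
  exact (withDensity_absolutelyContinuous _ _).ae_le h1

lemma good_inter (A : Set ℝ) : mu ((Ioo (0:ℝ) 1 ∩ {x | Irrational x}) ∩ A) = mu A := by
  apply measure_congr
  filter_upwards [ae_good] with x hx
  apply propext
  exact ⟨fun h => h.2, fun h => ⟨hx, h⟩⟩

lemma main_lim {y : ℝ} (hy : 0 < y) (M : ℕ) :
    Tendsto (fun N : ℕ => mu.real (S ((2 / log (2 + √3)) * N * y) N ∩ S ((2 / log (2 + √3)) * M * y) M))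
      atTop (𝓝 (exp (-1 / y) * mu.real (S ((2 / log (2 + √3)) * M * y) M))) := by
  have hl := log_pos3
  set r := mu.real (S ((2 / log (2 + √3)) * M * y) M) with hr
  have hr0 : 0 ≤ r := measureReal_nonneg
  have hr1 : r ≤ 1 := measureReal_le_one
  have tl := tail_lim hy
  set p : ℕ → ℝ := fun N => mu.real (E ((2 / log (2 + √3)) * N * y)) with hp
  have p0 : ∀ N, 0 ≤ p N := fun N => measureReal_nonneg
  have plim : Tendsto p atTop (𝓝 0) := by
    have := tl.mul tendsto_one_div_atTop_nhds_zero_nat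
    rw [mul_zero] at this
    refine this.congr' ?_
    filter_upwards [eventually_gt_atTop 0] with N hN
    have : (0:ℝ) < N := by exact_mod_cast hN
    simp only [hp]; field_simp
  have powlim : ∀ k : ℕ, Tendsto (fun N => (1 - p N) ^ (N - k)) atTop (𝓝 (exp (-1 / y))) := by
    intro k
    have h1 : Tendsto (fun N => (1 + -p N) ^ N) atTop (𝓝 (exp (-1 / y))) := by
      apply Real.tendsto_one_add_pow_exp_of_tendsto
      have := tl.neg
      rw [neg_div]
      refine this.congr fun N => ?_
      ring
    have h2 : Tendsto (fun N => (1 - p N) ^ k) atTop (𝓝 ((1 - 0) ^ k)) :=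
      (tendsto_const_nhds.sub plim).pow k
    have h3 := h1.div h2 (by simp)
    rw [sub_zero, one_pow, div_one] at h3
    refine h3.congr' ?_
    have : ∀ᶠ N in atTop, p N < 1 := plim.eventually (gt_mem_nhds one_pos)
    filter_upwards [this, eventually_ge_atTop k] with N hN hk
    have : 1 - p N ≠ 0 := by linarith
    rw [Pi.div_apply, ← sub_eq_add_neg, pow_sub₀ _ this hk, div_eq_mul_inv]
  rw [Metric.tendsto_atTop']
  intro δ hδ
  have θlim : Tendsto (fun g : ℕ => (5 * (19/20)^g : ℝ) * (1 + 1 / y)) atTop (𝓝 0) := by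
    have := (tendsto_pow_atTop_nhds_zero_of_lt_one (r := (19/20:ℝ)) (by norm_num) (by norm_num))
    simpa using (this.const_mul 5).mul_const (1 + 1 / y)
  obtain ⟨g, hg⟩ := (θlim.eventually (gt_mem_nhds hδ)).exists
  set θ : ℝ := 5 * (19/20)^g with hθ
  have θ0 : 0 ≤ θ := by positivity
  have blim : Tendsto (fun N : ℕ => (θ + 2 * (g * p N) + (N * p N) * (θ + 5 * g * p N)) +
      |(1 - p N) ^ (N - (M + g)) - exp (-1 / y)|) atTop
      (𝓝 ((θ + 2 * (g * 0) + (1 / y) * (θ + 5 * g * 0)) + |exp (-1 / y) - exp (-1 / y)|)) := by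
    refine Tendsto.add (Tendsto.add (Tendsto.add tendsto_const_nhds
      ((plim.const_mul _).const_mul _)) (tl.mul (tendsto_const_nhds.add (plim.const_mul _)))) ?_
    exact ((powlim _).sub tendsto_const_nhds).abs
  have hlt : (θ + 2 * (g * 0) + (1 / y) * (θ + 5 * g * 0)) + |exp (-1 / y) - exp (-1 / y)| < δ := by
    simp only [mul_zero, add_zero, sub_self, abs_zero]; linarith
  obtain ⟨N0, hN0⟩ := eventually_atTop.1 ((blim.eventually (gt_mem_nhds hlt)).and
    (eventually_ge_atTop (M + g)))
  refine ⟨N0, fun N hN => ?_⟩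
  obtain ⟨b1, b2⟩ := hN0 N hN.le
  refine lt_of_le_of_lt ?_ b1
  obtain ⟨m, rfl⟩ : ∃ m, N = M + (g + m) := ⟨N - (M + g), by omega⟩
  have hcc : (2 / log (2 + √3)) * M * y ≤ (2 / log (2 + √3)) * ((M + (g + m) : ℕ) : ℝ) * y := by
    gcongr; omega
  have hQ := Q_bound M g m hcc
  rw [← hr] at hQ
  have ep : mu.real (E ((2 / log (2 + √3)) * ((M + (g + m) : ℕ) : ℝ) * y)) = p (M + (g + m)) := rfl
  rw [ep, ← hθ] at hQ
  rw [show M + (g + m) - (M + g) = m by omega]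
  have hp0 := p0 (M + (g + m))
  generalize p (M + (g + m)) = P at *
  have hmN : (m:ℝ) * (P * (θ + 5 * g * P)) ≤ ((M + (g + m) : ℕ) : ℝ) * P * (θ + 5 * g * P) := by
    have h1 : (m:ℝ) ≤ ((M + (g + m) : ℕ) : ℝ) := by exact_mod_cast (by omega)
    have h2 : 0 ≤ P * (θ + 5 * g * P) := by positivity
    have h3 := mul_le_mul_of_nonneg_right h1 h2
    rwa [← mul_assoc (((M + (g + m) : ℕ) : ℝ))] at h3
  rw [Real.dist_eq]
  generalize mu.real (S _ _ ∩ _) = Q at *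
  have e : Q - exp (-1 / y) * r = (Q - r * (1 - P) ^ m) + r * ((1 - P)^m - exp (-1/y)) := by ring
  rw [e]
  refine (abs_add_le _ _).trans ?_
  rw [abs_mul, abs_of_nonneg hr0]
  have : r * |(1 - P)^m - exp (-1/y)| ≤ 1 * |(1 - P)^m - exp (-1/y)| := by gcongr
  linarith

/-- stability of the events `U_N = {max_{i ≤ N} a_i ≤ C₀ N y}`:
for each fixed `M`, `μ(U_N ∩ U_M) → e^{−1/y} μ(U_M)`. -/
theorem UN_stable :
    ∀ y : ℝ, 0 < y → ∀ M : ℕ, 1 ≤ M →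
      Filter.Tendsto
        (fun N : ℕ =>
          mu ({x : ℝ | x ∈ Set.Ioo (0 : ℝ) 1 ∧ Irrational x ∧
                ∀ i : ℕ, 1 ≤ i → i ≤ N →
                  (a i x : ℝ) ≤ (2 / Real.log (2 + Real.sqrt 3)) * N * y} ∩
              {x : ℝ | x ∈ Set.Ioo (0 : ℝ) 1 ∧ Irrational x ∧
                ∀ i : ℕ, 1 ≤ i → i ≤ M →
                  (a i x : ℝ) ≤ (2 / Real.log (2 + Real.sqrt 3)) * M * y}))
        Filter.atTop
        (nhds (ENNReal.ofReal (Real.exp (-1 / y)) *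
          mu {x : ℝ | x ∈ Set.Ioo (0 : ℝ) 1 ∧ Irrational x ∧
            ∀ i : ℕ, 1 ≤ i → i ≤ M →
              (a i x : ℝ) ≤ (2 / Real.log (2 + Real.sqrt 3)) * M * y})) := by
  intro y hy M _
  simp_rw [U_eq, ← inter_inter_distrib_left, good_inter]
  have h := ENNReal.tendsto_ofReal (main_lim hy M)
  rw [ENNReal.ofReal_mul (exp_pos _).le] at h
  have e : ∀ A : Set ℝ, ENNReal.ofReal (mu.real A) = mu A := fun A => ofReal_measureReal
  simpa only [e] using h

end SCF
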